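/- arXiv:2305.17780 — 3 statements merged into one kernel-verified Lean document; each statement's English description precedes it below -/
import Mathlib

section
/- Let p be a prime with p ≡ 2 (mod 3), let τ be in the complex upper half plane and set q = e^{2πiτ}. Then |log|R|| ≤ −4π²·p·√p/(3·log|q|), where R = ∏_{(a,b) ∈ O_cubes} R_{ā/p, b̄/p}³ (note log|q| < 0, so the right-hand side is positive). -/
/-!
Setup: the set `O_cubes` of pairs `(a, b) ∈ 𝔽_p² \ {0}` such that `a + b√ε` is a cube in
`𝔽_{p²}^×`, where `ε` is the least positive quadratic non-residue modulo `p` and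
`𝔽_{p²} = 𝔽_p(√ε)`.
-/

noncomputable section

/-- The least positive integer which is a quadratic non-residue modulo `p`. -/
def leastNonResidue (p : ℕ) : ℕ :=
  sInf {n : ℕ | 0 < n ∧ ¬∃ x : ZMod p, x ^ 2 = (n : ZMod p)}

/-- `ε ∈ 𝔽_p`: the reduction mod `p` of the least positive quadratic non-residue. -/
def nsEps (p : ℕ) : ZMod p := (leastNonResidue p : ZMod p)

/-- `O_cubes`: the set of pairs `(a, b) ∈ 𝔽_p² \ {(0,0)}` such that `a + b·r` is a cube in
`𝔽_{p²}^×`, where `𝔽_{p²}` is realised as `GaloisField p 2` and `r` is a square root of `ε`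
(so that `𝔽_{p²} = 𝔽_p(√ε)` and `r = √ε`). -/
def Ocubes (p : ℕ) [Fact p.Prime] (r : GaloisField p 2) : Set (ZMod p × ZMod p) :=
  {ab | ab ≠ 0 ∧ ∃ c : GaloisField p 2, c ≠ 0 ∧
    c ^ 3 = algebraMap (ZMod p) (GaloisField p 2) ab.1 +
      algebraMap (ZMod p) (GaloisField p 2) ab.2 * r}

end

/-- `q^x = e^{2πixτ}`. -/
noncomputable def qpow (τ : ℂ) (x : ℝ) : ℂ := Complex.exp (2 * Real.pi * Complex.I * x * τ)

/-- `e(x) = e^{2πix}`. -/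
noncomputable def e2πi (x : ℝ) : ℂ := Complex.exp (2 * Real.pi * Complex.I * x)

/-- The factor `R_{a₁,a₂}` (with `a₁ = ā/p`, `a₂ = b̄/p` for `(a, b) ∈ 𝔽_p²`):
`R_{a₁,a₂} = ∏_{n ≥ 0} (1 - q^{n+a₁}e(a₂))(1 - q^{n+1-a₁}e(-a₂))` for `a₁ ≠ 0`, and
`R_{0,a₂} = ∏_{n ≥ 1} (1 - qⁿe(a₂))(1 - qⁿe(-a₂))`. -/
noncomputable def Rfac (p : ℕ) (τ : ℂ) (ab : ZMod p × ZMod p) : ℂ :=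
  if ab.1 = 0 then
    ∏' n : ℕ, ((1 - qpow τ (n + 1) * e2πi ((ZMod.val ab.2 : ℝ) / p)) *
      (1 - qpow τ (n + 1) * e2πi (-((ZMod.val ab.2 : ℝ) / p))))
  else
    ∏' n : ℕ, ((1 - qpow τ (n + (ZMod.val ab.1 : ℝ) / p) * e2πi ((ZMod.val ab.2 : ℝ) / p)) *
      (1 - qpow τ (n + 1 - (ZMod.val ab.1 : ℝ) / p) * e2πi (-((ZMod.val ab.2 : ℝ) / p))))

/-- `R = ∏_{(a,b) ∈ O_cubes} R_{ā/p, b̄/p}³`. -/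
noncomputable def Rprod (p : ℕ) [Fact p.Prime] (r : GaloisField p 2) (τ : ℂ) : ℂ :=
  ∏ᶠ ab ∈ Ocubes p r, Rfac p τ ab ^ 3


section Stepanov

open Polynomial

/-- The Artin-Schreier type polynomial `w^p - U w - V`. -/
noncomputable def curvePoly {K : Type*} [Field K] (p : ℕ) (U V : K[X]) : K[X][X] :=
  X ^ p - (C U * X + C V)

theorem curvePoly_aux {K : Type*} [Field K] {p : ℕ} (hp : 2 ≤ p) (U V : K[X]) :
    (C U * X + C V : K[X][X]).degree < p := by
  refine lt_of_le_of_lt degree_linear_le ?_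
  exact_mod_cast hp

theorem curvePoly_monic {K : Type*} [Field K] {p : ℕ} (hp : 2 ≤ p) (U V : K[X]) :
    (curvePoly p U V).Monic := by
  exact monic_X_pow_sub (curvePoly_aux hp U V)

theorem curvePoly_natDegree {K : Type*} [Field K] {p : ℕ} (hp : 2 ≤ p) (U V : K[X]) :
    (curvePoly p U V).natDegree = p := by
  have := natDegree_sub_eq_left_of_natDegree_lt (p := (X ^ p : K[X][X])) (q := C U * X + C V)
    (by rw [natDegree_X_pow]; exact lt_of_le_of_lt natDegree_linear_le (by omega))
  rw [curvePoly, this, natDegree_X_pow]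

/-- Coefficients of weight `< n`. -/
def WFil {K : Type*} [Field K] (p n : ℕ) (h : K[X][X]) : Prop :=
  ∀ j i, (h.coeff j).coeff i ≠ 0 → p * i + (2 * p + 1) * j < n

/-- Leading weight exactly `n`. -/
def WLead {K : Type*} [Field K] (p n : ℕ) (h : K[X][X]) : Prop :=
  WFil p (n + 1) h ∧ ∃ j i, (h.coeff j).coeff i ≠ 0 ∧ p * i + (2 * p + 1) * j = n

theorem WFil.mono {K : Type*} [Field K] {p n m : ℕ} {h : K[X][X]} (hh : WFil p n h)
    (hnm : n ≤ m) : WFil p m h := fun j i hc => lt_of_lt_of_le (hh j i hc) hnm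

theorem WFil.zero {K : Type*} [Field K] {p n : ℕ} : WFil p n (0 : K[X][X]) := by
  intro j i h; simp at h

theorem WFil.add {K : Type*} [Field K] {p n : ℕ} {f g : K[X][X]} (hf : WFil p n f)
    (hg : WFil p n g) : WFil p n (f + g) := by
  intro j i h
  by_cases h1 : (f.coeff j).coeff i = 0
  · exact hg j i (by simpa [h1] using h)
  · exact hf j i h1

theorem WFil.sum {K : Type*} [Field K] {p n : ℕ} {ι : Type*} {s : Finset ι} {f : ι → K[X][X]}
    (hf : ∀ i ∈ s, WFil p n (f i)) : WFil p n (∑ i ∈ s, f i) := by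
  classical
  induction s using Finset.induction_on with
  | empty => simpa using WFil.zero
  | insert a s ha ih =>
    rw [Finset.sum_insert ha]
    exact (hf a (by simp)).add (ih fun i hi => hf i (by simp [hi]))

theorem WFil.smul {K : Type*} [Field K] {p n : ℕ} {f : K[X][X]} (c : K) (hf : WFil p n f) :
    WFil p n ((C c : K[X]) • f) := by
  intro j i h
  apply hf j i
  simp only [coeff_smul, smul_eq_mul, coeff_C_mul] at h
  exact right_ne_zero_of_mul h

theorem WLead.smul {K : Type*} [Field K] {p n : ℕ} {f : K[X][X]} {c : K} (hc : c ≠ 0)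
    (hf : WLead p n f) : WLead p n ((C c : K[X]) • f) := by
  refine ⟨hf.1.smul c, ?_⟩
  obtain ⟨j, i, h, hw⟩ := hf.2
  exact ⟨j, i, by simp [hc, h], hw⟩

theorem WLead.add {K : Type*} [Field K] {p n : ℕ} {f g : K[X][X]} (hf : WLead p n f)
    (hg : WFil p n g) : WLead p n (f + g) := by
  refine ⟨hf.1.add (hg.mono (by omega)), ?_⟩
  obtain ⟨j, i, h, hw⟩ := hf.2
  refine ⟨j, i, ?_, hw⟩
  have : (g.coeff j).coeff i = 0 := by
    by_contra h'
    have := hg j i h'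
    omega
  simpa [this] using h

theorem WLead.sum {K : Type*} [Field K] {p : ℕ} {ι : Type*} {s : Finset ι} {f : ι → K[X][X]}
    (wt : ι → ℕ) (hinj : Set.InjOn wt s)
    (hf : ∀ i ∈ s, WLead p (wt i) (f i)) (hs : s.Nonempty) :
    ∃ i ∈ s, WLead p (wt i) (∑ i ∈ s, f i) := by
  classical
  obtain ⟨a, ha, hmax⟩ := s.exists_max_image wt hs
  refine ⟨a, ha, ?_⟩
  rw [← Finset.add_sum_erase s f ha]
  refine (hf a ha).add (WFil.sum fun i hi => ?_)
  rw [Finset.mem_erase] at hi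
  have h1 := hmax i hi.2
  have h2 : wt i ≠ wt a := fun h => hi.1 (hinj hi.2 ha h)
  exact (hf i hi.2).1.mono (by omega)

/-- The normal form of an element of the coordinate ring. -/
noncomputable def wrep {K : Type*} [Field K] {p : ℕ} (hp : 2 ≤ p) {U V : K[X]}
    (f : AdjoinRoot (curvePoly p U V)) : K[X][X] :=
  AdjoinRoot.modByMonicHom (curvePoly_monic hp U V) f

theorem wrep_degree {K : Type*} [Field K] {p : ℕ} (hp : 2 ≤ p) {U V : K[X]}
    (f : AdjoinRoot (curvePoly p U V)) : (wrep hp f).degree < p := by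
  obtain ⟨g, rfl⟩ := AdjoinRoot.mk_surjective f
  have := degree_modByMonic_lt g (curvePoly_monic hp U V)
  rwa [degree_eq_natDegree (curvePoly_monic hp U V).ne_zero, curvePoly_natDegree hp] at this

theorem mk_wrep {K : Type*} [Field K] {p : ℕ} (hp : 2 ≤ p) {U V : K[X]}
    (f : AdjoinRoot (curvePoly p U V)) : AdjoinRoot.mk _ (wrep hp f) = f :=
  AdjoinRoot.mk_leftInverse (curvePoly_monic hp U V) f

theorem wrep_mk_of_degree_lt {K : Type*} [Field K] {p : ℕ} (hp : 2 ≤ p) {U V : K[X]}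
    {h : K[X][X]} (hd : h.degree < p) :
    wrep hp (AdjoinRoot.mk (curvePoly p U V) h) = h := by
  rw [wrep, AdjoinRoot.modByMonicHom_mk, modByMonic_eq_self_iff (curvePoly_monic hp U V),
    degree_eq_natDegree (curvePoly_monic hp U V).ne_zero, curvePoly_natDegree hp]
  exact hd

theorem wrep_root_mul {K : Type*} [Field K] {p : ℕ} (hp : 2 ≤ p) {U V : K[X]}
    (f : AdjoinRoot (curvePoly p U V)) :
    wrep hp (AdjoinRoot.root _ * f) =
      X * wrep hp f - C ((wrep hp f).coeff (p - 1)) * curvePoly p U V := by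
  have h1 : AdjoinRoot.root _ * f = AdjoinRoot.mk (curvePoly p U V)
      (X * wrep hp f - C ((wrep hp f).coeff (p - 1)) * curvePoly p U V) := by
    rw [map_sub, map_mul, map_mul, AdjoinRoot.mk_self, mul_zero, sub_zero, mk_wrep,
      AdjoinRoot.mk_X]
  rw [h1]
  apply wrep_mk_of_degree_lt
  rw [degree_lt_iff_coeff_zero]
  intro m hm
  have hd := wrep_degree hp f
  rw [degree_lt_iff_coeff_zero] at hd
  obtain ⟨k, rfl⟩ : ∃ k, m = k + 1 := ⟨m - 1, by omega⟩
  rw [coeff_sub, coeff_X_mul, coeff_C_mul]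
  rcases Nat.lt_or_ge p (k + 1) with h | h
  · rw [hd k (by omega), coeff_eq_zero_of_natDegree_lt (p := curvePoly p U V) (by rw [curvePoly_natDegree hp]; exact h)]
    simp
  · have hk : k + 1 = p := by omega
    have : (curvePoly p U V).coeff (k + 1) = 1 := by
      have := curvePoly_monic hp U V
      rw [Monic, leadingCoeff, curvePoly_natDegree hp] at this
      rw [hk, this]
    rw [this, show p - 1 = k by omega]
    simp

theorem curvePoly_coeff {K : Type*} [Field K] {p : ℕ} (hp : 2 ≤ p) (U V : K[X]) (j : ℕ)
    (hj : j < p) : (curvePoly p U V).coeff j = if j = 0 then -V else if j = 1 then -U else 0 := by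
  rw [curvePoly, coeff_sub, coeff_X_pow, if_neg (by omega), coeff_add, coeff_C_mul, coeff_X,
    coeff_C]
  rcases j with _ | _ | j <;> simp

theorem WFil.natDegree_le {K : Type*} [Field K] {p n : ℕ} {h : K[X][X]} (hh : WFil p n h)
    (j : ℕ) (hj : h.coeff j ≠ 0) : p * (h.coeff j).natDegree + (2 * p + 1) * j < n :=
  hh j _ (by simpa using hj)

theorem WLead.root_mul {K : Type*} [Field K] {p : ℕ} (hp : 2 ≤ p) {U V : K[X]}
    (hU : U.natDegree ≤ 2 * (p - 1)) (hV : V.natDegree = 2 * p + 1) {n : ℕ}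
    {f : AdjoinRoot (curvePoly p U V)} (hf : WLead p n (wrep hp f)) :
    WLead p (n + (2 * p + 1)) (wrep hp (AdjoinRoot.root _ * f)) := by
  set h := wrep hp f with hh
  have hd : ∀ m, p ≤ m → h.coeff m = 0 := by
    have := wrep_degree hp f
    rwa [degree_lt_iff_coeff_zero] at this
  have hd' : ∀ m, p ≤ m → (wrep hp (AdjoinRoot.root _ * f)).coeff m = 0 := by
    have := wrep_degree hp (AdjoinRoot.root _ * f)
    rwa [degree_lt_iff_coeff_zero] at this
  have hV0 : V ≠ 0 := by rintro rfl; simp at hV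
  obtain ⟨q, rfl⟩ : ∃ q, p = q + 2 := ⟨p - 2, by omega⟩
  have e0 : (wrep hp (AdjoinRoot.root _ * f)).coeff 0 = h.coeff (q + 1) * V := by
    rw [wrep_root_mul, coeff_sub, coeff_C_mul, curvePoly_coeff hp _ _ _ (by omega)]
    simp [hh]
  have e1 : (wrep hp (AdjoinRoot.root _ * f)).coeff 1 = h.coeff 0 + h.coeff (q + 1) * U := by
    rw [wrep_root_mul, coeff_sub, coeff_C_mul, curvePoly_coeff hp _ _ _ (by omega), coeff_X_mul]
    simp [hh]
  have e2 : ∀ j, 1 ≤ j → j + 1 < q + 2 →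
      (wrep hp (AdjoinRoot.root _ * f)).coeff (j + 1) = h.coeff j := by
    intro j h1 h2
    rw [wrep_root_mul, coeff_sub, coeff_C_mul, curvePoly_coeff hp _ _ _ (by omega), coeff_X_mul,
      if_neg (by omega), if_neg (by omega)]
    simp [hh]
  -- degree bound for the wrapped term
  have hwrapU : ∀ i, (h.coeff (q + 1) * U).coeff i ≠ 0 → (q + 2) * i < n := by
    intro i hi
    have hne : h.coeff (q + 1) ≠ 0 := by
      intro h0; rw [h0] at hi; simp at hi
    have h1 := hf.1.natDegree_le _ hne
    have h2 : i ≤ (h.coeff (q + 1)).natDegree + U.natDegree :=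
      (le_natDegree_of_ne_zero hi).trans natDegree_mul_le
    simp only [Nat.add_succ_sub_one] at hU
    have h3 : i ≤ (h.coeff (q + 1)).natDegree + 2 * (q + 1) := by omega
    nlinarith [Nat.mul_le_mul_left (q + 2) h3]
  have hwrapV : h.coeff (q + 1) ≠ 0 → (h.coeff (q + 1) * V).natDegree =
      (h.coeff (q + 1)).natDegree + (2 * (q + 2) + 1) := by
    intro hne
    rw [natDegree_mul hne hV0, hV]
  constructor
  · intro j i hji
    rcases Nat.lt_or_ge j (q + 2) with hj | hj
    swap
    · rw [hd' j hj] at hji; simp at hji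
    rcases j with _ | _ | j
    · rw [e0] at hji
      have hne : h.coeff (q + 1) ≠ 0 := by
        intro h0; rw [h0] at hji; simp at hji
      have h1 := hf.1.natDegree_le _ hne
      have h2 := le_natDegree_of_ne_zero hji
      rw [hwrapV hne] at h2
      nlinarith [Nat.mul_le_mul_left (q + 2) h2]
    · rw [zero_add, e1] at hji
      by_cases h0 : (h.coeff 0).coeff i = 0
      · have := hwrapU i (by simpa [h0] using hji)
        omega
      · have := hf.1 0 i h0
        omega
    · rw [e2 (j + 1) (by omega) hj] at hji
      have := hf.1 (j + 1) i hji
      linarith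
  · obtain ⟨j, i, hji, hw⟩ := hf.2
    rcases Nat.lt_or_ge j (q + 2) with hj | hj
    swap
    · rw [hd j hj] at hji; simp at hji
    rcases Nat.lt_or_ge j (q + 1) with hj1 | hj1
    · refine ⟨j + 1, i, ?_, by rw [← hw]; ring⟩
      rcases j with _ | j
      · rw [zero_add, e1, coeff_add]
        have : (h.coeff (q + 1) * U).coeff i = 0 := by
          by_contra h'
          have := hwrapU i h'
          omega
        simpa [this] using hji
      · rw [e2 (j + 1) (by omega) (by omega)]
        exact hji
    · have hj2 : j = q + 1 := by omega
      subst hj2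
      have hne : h.coeff (q + 1) ≠ 0 := by
        intro h0; rw [h0] at hji; simp at hji
      refine ⟨0, (h.coeff (q + 1) * V).natDegree, ?_, ?_⟩
      · rw [e0]
        simpa using ⟨hne, hV0⟩
      · rw [hwrapV hne]
        have h1 := hf.1.natDegree_le _ hne
        have h2 := le_natDegree_of_ne_zero hji
        have h3 : (h.coeff (q + 1)).natDegree = i := by
          refine le_antisymm ?_ h2
          have : (q + 2) * (h.coeff (q + 1)).natDegree ≤ (q + 2) * i := by omega
          exact Nat.le_of_mul_le_mul_left this (by omega)
        rw [h3, ← hw]; ring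

theorem wrep_smul {K : Type*} [Field K] {p : ℕ} (hp : 2 ≤ p) {U V : K[X]} (c : K[X])
    (f : AdjoinRoot (curvePoly p U V)) : wrep hp (c • f) = c • wrep hp f := by
  simp [wrep]

theorem WLead.X_smul {K : Type*} [Field K] {p : ℕ} {n : ℕ}
    {h : K[X][X]} (hf : WLead p n h) :
    WLead p (n + p) ((X : K[X]) • h) := by
  constructor
  · intro j i hji
    rw [coeff_smul, smul_eq_mul] at hji
    rcases i with _ | i
    · simp at hji
    · rw [coeff_X_mul] at hji
      have := hf.1 j i hji
      linarith
  · obtain ⟨j, i, hji, hw⟩ := hf.2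
    exact ⟨j, i + 1, by rwa [coeff_smul, smul_eq_mul, coeff_X_mul], by rw [← hw]; ring⟩

/-- The monomial `x^i w^j`. -/
noncomputable def monA {K : Type*} [Field K] (p : ℕ) (U V : K[X]) (i j : ℕ) :
    AdjoinRoot (curvePoly p U V) := (X ^ i : K[X]) • (AdjoinRoot.root _) ^ j

theorem monA_mul {K : Type*} [Field K] (p : ℕ) (U V : K[X]) (i j i' j' : ℕ) :
    monA p U V i j * monA p U V i' j' = monA p U V (i + i') (j + j') := by
  simp only [monA, smul_mul_smul_comm, ← pow_add]

theorem monA_pow {K : Type*} [Field K] (p : ℕ) (U V : K[X]) (i j k : ℕ) :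
    monA p U V i j ^ k = monA p U V (k * i) (k * j) := by
  rw [monA, _root_.smul_pow, ← pow_mul, ← pow_mul, mul_comm i, mul_comm j, monA]

theorem wLead_monA {K : Type*} [Field K] {p : ℕ} (hp : 2 ≤ p) {U V : K[X]}
    (hU : U.natDegree ≤ 2 * (p - 1)) (hV : V.natDegree = 2 * p + 1) (i j : ℕ) :
    WLead p (p * i + (2 * p + 1) * j) (wrep hp (monA p U V i j)) := by
  have h0 : wrep hp (1 : AdjoinRoot (curvePoly p U V)) = 1 := by
    have := wrep_mk_of_degree_lt hp (U := U) (V := V) (h := 1)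
      (by rw [degree_one]; exact_mod_cast (by omega : 0 < p))
    rwa [map_one] at this
  induction i with
  | zero =>
    induction j with
    | zero =>
      simp only [monA, pow_zero, one_smul, mul_zero, add_zero, h0]
      constructor
      · intro j i h
        rw [coeff_one] at h
        split_ifs at h with h1
        · rw [coeff_one] at h
          split_ifs at h with h2
          · subst h1; subst h2; simp
          · simp at h
        · simp at h
      · exact ⟨0, 0, by simp, by simp⟩
    | succ j ih =>
      have := ih.root_mul hp hU hV
      simp only [monA, pow_zero, one_smul] at this ⊢
      rw [← pow_succ'] at this
      convert this using 1
      ring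
  | succ i ih =>
    have := ih.X_smul
    rw [← wrep_smul, monA, smul_smul, ← pow_succ'] at this
    rw [monA]
    convert this using 1
    ring

theorem card_WFil {K : Type*} [Field K] [Fintype K] {p : ℕ} (hp : 2 ≤ p) {U V : K[X]} (N : ℕ)
    {ι : Type*} [Fintype ι] (f : ι → AdjoinRoot (curvePoly p U V)) (hinj : Function.Injective f)
    (hf : ∀ i, WFil p N (wrep hp (f i))) : Fintype.card ι ≤ Fintype.card K ^ N := by
  classical
  let g : ι → (Fin N → K) := fun t n =>
    ((wrep hp (f t)).coeff (n % p)).coeff ((n - (2 * p + 1) * (n % p)) / p)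
  have hg : Function.Injective g := by
    intro a b hab
    apply hinj
    have : wrep hp (f a) = wrep hp (f b) := by
      ext j i
      rcases Nat.lt_or_ge j p with hj | hj
      swap
      · have h1 := wrep_degree hp (f a)
        have h2 := wrep_degree hp (f b)
        rw [degree_lt_iff_coeff_zero] at h1 h2
        rw [h1 j hj, h2 j hj]
      rcases Nat.lt_or_ge (p * i + (2 * p + 1) * j) N with hw | hw
      · have := congrFun hab ⟨_, hw⟩
        have e1 : (p * i + (2 * p + 1) * j) % p = j := by
          rw [show p * i + (2 * p + 1) * j = j + p * (i + 2 * j) by ring,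
            Nat.add_mul_mod_self_left, Nat.mod_eq_of_lt hj]
        simp only [g, e1, Nat.add_sub_cancel, Nat.mul_div_cancel_left _ (by omega : 0 < p)] at this
        exact this
      · have h1 : ((wrep hp (f a)).coeff j).coeff i = 0 := by
          by_contra h
          have := hf a j i h
          omega
        have h2 : ((wrep hp (f b)).coeff j).coeff i = 0 := by
          by_contra h
          have := hf b j i h
          omega
        rw [h1, h2]
    rw [← mk_wrep hp (f a), this, mk_wrep]
  have := Fintype.card_le_of_injective g hg
  simpa using this

/-- Stepanov-Bombieri upper bound. -/
theorem stepanov_bound {K : Type*} [Field K] [Fintype K] {p : ℕ} [hpF : Fact p.Prime] [CharP K p]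
    {μ ν G c : ℕ} (hcard : Fintype.card K = p ^ μ * p ^ ν) (hμν : p ^ μ ≤ p * p ^ ν)
    (hG : G = (2 * p + 1) * (p - 1)) (hc : c = p * (G + 1) + 1)
    (hlarge : c + G < p ^ ν) (D B : K[X]) (hD : D.natDegree = 2) (hB : B.natDegree = 3)
    (S : Finset K)
    (hS : ∀ x ∈ S, D.eval x ≠ 0 ∧ ∃ y, y ^ p - y = B.eval x / D.eval x) :
    p * S.card ≤ p ^ μ * p ^ ν + p ^ ν * (2 * G + 1 + c) := by
  classical
  have hp : 2 ≤ p := hpF.out.two_le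
  set r := p ^ μ with hr
  set r' := p ^ ν with hr'
  set U : K[X] := D ^ (p - 1) with hU
  set V : K[X] := D ^ (p - 1) * B with hV
  have hD0 : D ≠ 0 := by rintro rfl; simp at hD
  have hB0 : B ≠ 0 := by rintro rfl; simp at hB
  have hUd : U.natDegree ≤ 2 * (p - 1) := by
    rw [hU, natDegree_pow, hD]; omega
  have hVd : V.natDegree = 2 * p + 1 := by
    rw [hV, natDegree_mul (pow_ne_zero _ hD0) hB0, natDegree_pow, hD, hB]; omega
  -- the monomial indices
  let jj : ℕ → ℕ := fun n => (G + n) % p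
  let ii : ℕ → ℕ := fun n => ((G + n) - (2 * p + 1) * jj n) / p
  have hwt : ∀ n, p * ii n + (2 * p + 1) * jj n = G + n := by
    intro n
    have h1 : jj n ≤ p - 1 := by
      have := Nat.mod_lt (G + n) (by omega : 0 < p)
      simp only [jj]; omega
    have h2 : (2 * p + 1) * jj n ≤ G + n := by
      have := Nat.mul_le_mul_left (2 * p + 1) h1
      omega
    have h3 : p ∣ (G + n) - (2 * p + 1) * jj n := by
      have h4 : (2 * p + 1) * jj n ≡ G + n [MOD p] := by
        have : (2 * p + 1) * jj n = jj n + p * (2 * jj n) := by ring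
        rw [this]
        unfold Nat.ModEq
        rw [Nat.add_mul_mod_self_left]
        simp only [jj, Nat.mod_mod]
      exact (Nat.modEq_iff_dvd' h2).1 h4
    simp only [ii]
    rw [Nat.mul_div_cancel' h3]
    omega
  set m' := r + c with hm'
  have hr'1 : 1 ≤ r' := by omega
  -- H and δ
  let H : (Fin m' × Fin r' → K) → AdjoinRoot (curvePoly p U V) := fun v =>
    ∑ st : Fin m' × Fin r', (C (v st) : K[X]) •
      (monA p U V (ii st.2) (jj st.2) * monA p U V (ii st.1) (jj st.1) ^ r')
  let δ : (Fin m' × Fin r' → K) → AdjoinRoot (curvePoly p U V) := fun v =>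
    ∑ st : Fin m' × Fin r', (C (v st ^ r) : K[X]) •
      (monA p U V (ii st.2) (jj st.2) ^ r * monA p U V (ii st.1) (jj st.1))
  -- pigeonhole
  have hker : ∃ v : Fin m' × Fin r' → K, v ≠ 0 ∧ δ v = 0 := by
    have hnot : ¬ Function.Injective δ := by
      intro hinj
      have hle := card_WFil hp (r * G + r * r' + G + m') δ hinj (by
        intro v
        have : wrep hp (δ v) = ∑ st : Fin m' × Fin r', (C (v st ^ r) : K[X]) •
            wrep hp (monA p U V (ii st.2) (jj st.2) ^ r * monA p U V (ii st.1) (jj st.1)) := by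
          simp only [δ, wrep, map_sum, map_smul]
        rw [this]
        refine WFil.sum fun st _ => WFil.smul _ ?_
        rw [monA_pow, monA_mul]
        refine (wLead_monA hp hUd hVd _ _).1.mono ?_
        have e : p * (r * ii st.2 + ii st.1) + (2 * p + 1) * (r * jj st.2 + jj st.1)
            = r * (G + st.2) + (G + st.1) := by
          rw [← hwt, ← hwt]; ring
        rw [e]
        have h1 : (st.2 : ℕ) ≤ r' := st.2.2.le
        have h2 := st.1.2
        nlinarith [Nat.mul_le_mul_left r h1])
      simp only [Fintype.card_pi, Finset.prod_const, Finset.card_univ, Fintype.card_prod,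
        Fintype.card_fin] at hle
      have hK : 1 < Fintype.card K := Fintype.one_lt_card
      have := (Nat.pow_le_pow_iff_right hK).1 hle
      have hkey : c * r' > r * (G + 1) + G + c := by
        have h1 : r * (G + 1) ≤ p * r' * (G + 1) := Nat.mul_le_mul_right _ hμν
        have h2 : c * r' = p * r' * (G + 1) + r' := by rw [hc]; ring
        omega
      have : (r + c) * r' = r * r' + c * r' := by ring
      nlinarith
    simp only [Function.Injective, not_forall] at hnot
    obtain ⟨a, b, hab, hne⟩ := hnot
    refine ⟨a - b, sub_ne_zero.2 hne, ?_⟩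
    have : δ (a - b) = δ a - δ b := by
      simp only [δ, ← Finset.sum_sub_distrib, ← sub_smul, ← C_sub, Pi.sub_apply]
      refine Finset.sum_congr rfl fun st _ => ?_
      rw [hr, sub_pow_char_pow]
    rw [this, hab, sub_self]
  obtain ⟨v, hv, hδ⟩ := hker
  -- H v has a leading weight
  have hlead : ∃ n, n < r * r' + r' * (2 * G + 1 + c) ∧ WLead p n (wrep hp (H v)) := by
    have h1 : wrep hp (H v) = ∑ st ∈ Finset.univ.filter (fun st => v st ≠ 0),
        (C (v st) : K[X]) •
      wrep hp (monA p U V (ii st.2) (jj st.2) * monA p U V (ii st.1) (jj st.1) ^ r') := by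
      simp only [H, wrep, map_sum, map_smul]
      rw [Finset.sum_filter]
      refine Finset.sum_congr rfl fun st _ => ?_
      split_ifs with h
      · rfl
      · rw [not_not.1 h]; simp
    obtain ⟨st, _, hl⟩ := WLead.sum (p := p)
      (s := Finset.univ.filter (fun st : Fin m' × Fin r' => v st ≠ 0))
      (f := fun st => (C (v st) : K[X]) •
        wrep hp (monA p U V (ii st.2) (jj st.2) * monA p U V (ii st.1) (jj st.1) ^ r'))
      (fun st => (G + st.2) + r' * (G + st.1)) (by
        rintro ⟨s, t⟩ _ ⟨s', t'⟩ _ h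
        simp only at h
        have h' : (t : ℕ) + r' * s = t' + r' * s' := by
          have e1 : r' * (G + (s : ℕ)) = r' * G + r' * s := by ring
          have e2 : r' * (G + (s' : ℕ)) = r' * G + r' * s' := by ring
          omega
        have ht : (t : ℕ) = t' := by
          have := congrArg (· % r') h'
          simpa [Nat.add_mul_mod_self_left, Nat.mod_eq_of_lt t.2, Nat.mod_eq_of_lt t'.2] using this
        have hs : (s : ℕ) = s' := by
          rw [ht] at h'
          exact Nat.eq_of_mul_eq_mul_left hr'1 (Nat.add_left_cancel h')
        ext
        · exact hs
        · exact ht) (by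
        intro st hst
        refine WLead.smul (by simpa using hst) ?_
        rw [monA_pow, monA_mul]
        have := wLead_monA hp hUd hVd (ii st.2 + r' * ii st.1) (jj st.2 + r' * jj st.1)
        convert this using 1
        rw [← hwt, ← hwt]; ring) (by
        obtain ⟨st, hst⟩ := Function.ne_iff.1 hv
        exact ⟨st, by simpa using hst⟩)
    refine ⟨_, ?_, by rw [h1]; exact hl⟩
    have h2 := st.2.2
    have h3 : (st.1 : ℕ) + 1 ≤ r + c := st.1.2
    have h4 : r' * (G + (st.1 : ℕ)) + r' ≤ r' * (G + (r + c)) := by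
      have := Nat.mul_le_mul_left r' (by omega : G + (st.1 : ℕ) + 1 ≤ G + (r + c))
      linarith
    have h5 : G ≤ r' * G := Nat.le_mul_of_pos_left _ hr'1
    nlinarith
  obtain ⟨n, hn, hl⟩ := hlead
  -- vanishing
  have hvan : ∀ x ∈ S, ∀ j, ((wrep hp (H v)).coeff j).eval x = 0 := by
    intro x hx j
    obtain ⟨hDx, y, hy⟩ := hS x hx
    have hz : (wrep hp (H v)).map (evalRingHom x) = 0 := by
      refine eq_zero_of_natDegree_lt_card_of_eval_eq_zero (ι := Fin p) _
        (f := fun k => D.eval x * (y + (k : ℕ))) ?_ ?_ ?_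
      · intro a b hab
        have h1 := mul_left_cancel₀ hDx hab
        have h2 : ((a : ℕ) : K) = ((b : ℕ) : K) := add_left_cancel h1
        have := CharP.natCast_injOn_Iio K p a.2 b.2 h2
        exact Fin.ext this
      · intro k
        set w := D.eval x * (y + (k : ℕ)) with hw
        have hroot : (curvePoly p U V).eval₂ (evalRingHom x) w = 0 := by
          have h1 : (y + ((k : ℕ) : K)) ^ p = y ^ p + ((k : ℕ) : K) := by
            have h3 : ((k : ℕ) : K) ^ p = ((k : ℕ) : K) := map_natCast (frobenius K p) (k : ℕ)
            rw [add_pow_char, h3]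
          have h2 : y ^ p = y + B.eval x / D.eval x := by rw [← hy]; ring
          simp only [curvePoly, eval₂_sub, eval₂_add, eval₂_mul, eval₂_pow, eval₂_X, eval₂_C,
            coe_evalRingHom, hU, hV, eval_mul, eval_pow]
          rw [hw, mul_pow, h1, h2]
          have h4 : D.eval x ^ p = D.eval x ^ (p - 1) * D.eval x := by
            rw [← pow_succ, Nat.sub_add_cancel (by omega)]
          rw [h4]
          field_simp
          ring
        let φ : AdjoinRoot (curvePoly p U V) →+* K := AdjoinRoot.lift (evalRingHom x) w hroot
        have hφ : φ (H v) = ((wrep hp (H v)).map (evalRingHom x)).eval w := by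
          conv_lhs => rw [← mk_wrep hp (H v)]
          rw [AdjoinRoot.lift_mk, eval_map]
        rw [← hφ]
        have hφC : ∀ (a : K) (f : AdjoinRoot (curvePoly p U V)), φ ((C a : K[X]) • f) = a * φ f := by
          intro a f
          rw [Algebra.smul_def, map_mul]
          congr 1
          change φ (AdjoinRoot.of _ (C a)) = a
          rw [AdjoinRoot.lift_of]; simp
        have hpow : φ (H v) ^ r = φ (δ v) := by
          simp only [H, δ, map_sum, hφC]
          rw [hr, sum_pow_char_pow, ← hr]
          refine Finset.sum_congr rfl fun st _ => ?_
          rw [map_mul, map_mul, map_pow, map_pow, mul_pow, mul_pow, ← pow_mul, mul_comm r' r,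
            ← hcard, FiniteField.pow_card]
        rw [hδ, map_zero] at hpow
        exact pow_eq_zero_iff (by positivity) |>.1 hpow
      · rw [Fintype.card_fin]
        have h1 : ((wrep hp (H v)).map (evalRingHom x)).degree < p :=
          lt_of_le_of_lt degree_map_le (wrep_degree hp _)
        by_cases h0 : (wrep hp (H v)).map (evalRingHom x) = 0
        · rw [h0]; simp; omega
        · exact (natDegree_lt_iff_degree_lt h0).2 h1
    have := congrArg (fun f => f.coeff j) hz
    simpa using this
  obtain ⟨j, i, hji, hw⟩ := hl.2
  have hne : (wrep hp (H v)).coeff j ≠ 0 := by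
    intro h; rw [h] at hji; simp at hji
  have h1 := hl.1.natDegree_le j hne
  have h2 : S.card ≤ ((wrep hp (H v)).coeff j).natDegree := by
    apply card_le_degree_of_subset_roots (p := (wrep hp (H v)).coeff j)
    intro x hx
    rw [mem_roots hne]
    exact hvan x hx j
  have := Nat.mul_le_mul_left p h2
  omega

end Stepanov

section LRec

open Polynomial

noncomputable instance gfFintype (p : ℕ) [Fact p.Prime] (j : ℕ) : Fintype (GaloisField p j) :=
  Fintype.ofFinite _

theorem monicSet_finite (p : ℕ) [Fact p.Prime] (n : ℕ) :
    {h : (ZMod p)[X] | h.Monic ∧ h.natDegree = n}.Finite := by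
  have e := (Polynomial.monicEquivDegreeLT (R := ZMod p) n).trans
    (Polynomial.degreeLTEquiv (ZMod p) n).toEquiv
  exact (Finite.of_equiv _ e.symm : Finite {h : (ZMod p)[X] // h.Monic ∧ h.natDegree = n})

/-- Monic polynomials of degree `n`. -/
noncomputable def monicDeg (p : ℕ) [Fact p.Prime] (n : ℕ) : Finset (ZMod p)[X] :=
  (monicSet_finite p n).toFinset

theorem mem_monicDeg {p : ℕ} [Fact p.Prime] {n : ℕ} {h : (ZMod p)[X]} :
    h ∈ monicDeg p n ↔ h.Monic ∧ h.natDegree = n := by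
  simp [monicDeg]

/-- The characteristic polynomial of `x` as a power of the minimal polynomial. -/
noncomputable def cpoly (p : ℕ) [Fact p.Prime] (j : ℕ) (x : GaloisField p j) : (ZMod p)[X] :=
  (minpoly (ZMod p) x) ^ (j / (minpoly (ZMod p) x).natDegree)

theorem gf_integral {p : ℕ} [Fact p.Prime] {j : ℕ} (x : GaloisField p j) :
    IsIntegral (ZMod p) x := IsIntegral.of_finite _ _

theorem gf_minpoly_dvd {p : ℕ} [Fact p.Prime] {j : ℕ} (hj : j ≠ 0) (x : GaloisField p j) :
    (minpoly (ZMod p) x).natDegree ∣ j := by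
  have := minpoly.degree_dvd (gf_integral x)
  rwa [GaloisField.finrank p hj] at this

theorem cpoly_mem {p : ℕ} [Fact p.Prime] {j : ℕ} (hj : j ≠ 0) (x : GaloisField p j) :
    cpoly p j x ∈ monicDeg p j := by
  rw [mem_monicDeg]
  have hm := minpoly.monic (gf_integral x)
  refine ⟨hm.pow _, ?_⟩
  rw [cpoly, hm.natDegree_pow]
  exact Nat.div_mul_cancel (gf_minpoly_dvd hj x)

open Classical in
theorem card_minpoly_eq {p : ℕ} [Fact p.Prime] {j : ℕ} (hj : j ≠ 0) {P : (ZMod p)[X]}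
    (hP : Irreducible P) (hPm : P.Monic) :
    (Finset.univ.filter fun x : GaloisField p j => minpoly (ZMod p) x = P).card =
      if P.natDegree ∣ j then P.natDegree else 0 := by
  split_ifs with hd
  · have h1 : P ∣ X ^ (p ^ j) - X := by
      have := hP.natDegree_dvd_iff_dvd_X_pow_card_pow_sub_X.mp hd
      simpa using this
    have hcard : Fintype.card (GaloisField p j) = p ^ j := by
      rw [← Nat.card_eq_fintype_card, GaloisField.card p j hj]
    have hsp : (P.map (algebraMap (ZMod p) (GaloisField p j))).Splits := by
      have h2 := (FiniteField.isSplittingField_of_card_eq (K := GaloisField p j) p j hcard).splits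
      refine h2.of_dvd ?_ (Polynomial.map_dvd _ h1)
      rw [Polynomial.map_ne_zero_iff (algebraMap (ZMod p) (GaloisField p j)).injective]
      apply FiniteField.X_pow_card_pow_sub_X_ne_zero _ hj (Fact.out : p.Prime).one_lt
    rw [← Polynomial.card_rootSet_eq_natDegree (PerfectField.separable_of_irreducible hP) hsp,
      ← Set.toFinset_card]
    congr 1
    ext x
    simp only [Finset.mem_filter, Finset.mem_univ, true_and, Set.mem_toFinset,
      Polynomial.mem_rootSet]
    constructor
    · rintro rfl
      exact ⟨hP.ne_zero, minpoly.aeval _ _⟩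
    · rintro ⟨_, h⟩
      exact (minpoly.eq_of_irreducible_of_monic hP h hPm).symm
  · rw [Finset.card_eq_zero, Finset.filter_eq_empty_iff]
    rintro x - rfl
    exact hd (gf_minpoly_dvd hj x)

theorem count_mult (n d c : ℕ) (hd : 0 < d) (hc : c * d ≤ n) :
    ((Finset.Icc 1 n).filter fun j => d ∣ j ∧ j / d ≤ c).card = c := by
  have : ((Finset.Icc 1 n).filter fun j => d ∣ j ∧ j / d ≤ c) =
      (Finset.Icc 1 c).image (fun k => k * d) := by
    ext j
    simp only [Finset.mem_filter, Finset.mem_Icc, Finset.mem_image]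
    constructor
    · rintro ⟨⟨h1, h2⟩, ⟨k, rfl⟩, h4⟩
      rw [Nat.mul_div_cancel_left _ hd] at h4
      refine ⟨k, ⟨?_, h4⟩, mul_comm _ _⟩
      rcases Nat.eq_zero_or_pos k with rfl | h
      · simp at h1
      · exact h
    · rintro ⟨k, ⟨h1, h2⟩, rfl⟩
      refine ⟨⟨Nat.mul_pos h1 hd, le_trans (Nat.mul_le_mul_right _ h2) hc⟩, dvd_mul_left _ _, ?_⟩
      rwa [Nat.mul_div_cancel _ hd]
  rw [this, Finset.card_image_of_injective]
  · simp
  · intro a b hab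
    exact Nat.eq_of_mul_eq_mul_right hd hab

open Classical in
theorem count_cpoly_dvd {p : ℕ} [Fact p.Prime] {n : ℕ} {h : (ZMod p)[X]} (hm : h.Monic)
    (hn : h.natDegree = n) :
    ∑ j ∈ Finset.Icc 1 n, (Finset.univ.filter fun x : GaloisField p j => cpoly p j x ∣ h).card
      = n := by
  have h0 := hm.ne_zero
  set s := UniqueFactorizationMonoid.normalizedFactors h with hs
  have hmem : ∀ P ∈ s, Irreducible P ∧ P.Monic ∧ P ∣ h := fun P hP =>
    (Polynomial.mem_normalizedFactors_iff h0).mp hP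
  have hpow : ∀ P ∈ s, ∀ k, P ^ k ∣ h ↔ k ≤ s.count P := by
    intro P hP k
    rw [pow_dvd_iff_le_emultiplicity,
      UniqueFactorizationMonoid.emultiplicity_eq_count_normalizedFactors (hmem P hP).1 h0,
      (hmem P hP).2.1.normalize_eq_self]
    exact Nat.cast_le
  have hdeg : ∑ P ∈ s.toFinset, s.count P * P.natDegree = n := by
    rw [← hn]
    have := Polynomial.leadingCoeff_mul_prod_normalizedFactors h
    rw [hm.leadingCoeff, C_1, one_mul] at this
    conv_rhs => rw [← this]
    rw [Polynomial.natDegree_multiset_prod_of_monic _ (fun P hP => (hmem P hP).2.1),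
      Finset.sum_multiset_map_count]
    simp [hs]
  have key : ∀ j ∈ Finset.Icc 1 n,
      (Finset.univ.filter fun x : GaloisField p j => cpoly p j x ∣ h).card =
      ∑ P ∈ s.toFinset, if P.natDegree ∣ j ∧ j / P.natDegree ≤ s.count P
        then P.natDegree else 0 := by
    intro j hj
    have hj0 : j ≠ 0 := by
      have := (Finset.mem_Icc.mp hj).1
      omega
    rw [Finset.card_eq_sum_card_fiberwise (f := fun x => minpoly (ZMod p) x) (t := s.toFinset)]
    · refine Finset.sum_congr rfl fun P hP => ?_
      rw [Multiset.mem_toFinset] at hP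
      have hc := card_minpoly_eq hj0 (hmem P hP).1 (hmem P hP).2.1
      by_cases hk : j / P.natDegree ≤ s.count P
      · simp only [hk, and_true]
        rw [← hc, Finset.filter_filter]
        congr 1
        ext x
        simp only [Finset.mem_filter, Finset.mem_univ, true_and, and_iff_right_iff_imp]
        rintro rfl
        exact (hpow _ hP _).mpr hk
      · simp only [hk, and_false, if_false]
        rw [Finset.card_eq_zero, Finset.filter_filter, Finset.filter_eq_empty_iff]
        rintro x - ⟨h1, rfl⟩
        exact hk ((hpow _ hP _).mp h1)
    · intro x hx
      simp only [Finset.coe_filter, Finset.mem_univ, true_and, Set.mem_ofPred_eq] at hx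
      simp only [Finset.mem_coe, Multiset.mem_toFinset]
      rw [hs, Polynomial.mem_normalizedFactors_iff h0]
      refine ⟨minpoly.irreducible (gf_integral x), minpoly.monic (gf_integral x), ?_⟩
      refine dvd_trans (dvd_pow_self _ ?_) hx
      have hd := gf_minpoly_dvd hj0 x
      have := Nat.div_pos (Nat.le_of_dvd (Nat.pos_of_ne_zero hj0) hd)
        (minpoly.natDegree_pos (gf_integral x))
      omega
  rw [Finset.sum_congr rfl key, Finset.sum_comm]
  conv_rhs => rw [← hdeg]
  refine Finset.sum_congr rfl fun P hP => ?_
  rw [← Finset.sum_filter, Finset.sum_const, smul_eq_mul]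
  rw [count_mult n _ _ (hmem P (Multiset.mem_toFinset.mp hP)).1.natDegree_pos]
  have := (hpow P (Multiset.mem_toFinset.mp hP) _).mpr le_rfl
  have := Polynomial.natDegree_le_of_dvd this h0
  rwa [(hmem P (Multiset.mem_toFinset.mp hP)).2.1.natDegree_pow, hn] at this

theorem sum_monicDeg_mul {p : ℕ} [Fact p.Prime] (Λ : (ZMod p)[X] → ℂ)
    (hΛ : ∀ f g, f.Monic → g.Monic → Λ (f * g) = Λ f * Λ g) {j n : ℕ} (hjn : j ≤ n)
    {f : (ZMod p)[X]} (hf : f ∈ monicDeg p j) [DecidablePred fun h => f ∣ h] :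
    ∑ h ∈ (monicDeg p n).filter (fun h => f ∣ h), Λ h =
      Λ f * ∑ g ∈ monicDeg p (n - j), Λ g := by
  rw [mem_monicDeg] at hf
  rw [Finset.mul_sum]
  symm
  refine Finset.sum_bij (fun g _ => f * g) ?_ ?_ ?_ ?_
  · intro g hg
    rw [mem_monicDeg] at hg
    rw [Finset.mem_filter, mem_monicDeg]
    refine ⟨⟨hf.1.mul hg.1, ?_⟩, dvd_mul_right _ _⟩
    rw [hf.1.natDegree_mul hg.1]
    omega
  · intro a _ b _ hab
    exact mul_left_cancel₀ hf.1.ne_zero hab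
  · intro h hh
    rw [Finset.mem_filter, mem_monicDeg] at hh
    obtain ⟨⟨h1, h2⟩, g, rfl⟩ := hh
    have hg : g.Monic := hf.1.of_mul_monic_left h1
    refine ⟨g, ?_, rfl⟩
    rw [mem_monicDeg]
    refine ⟨hg, ?_⟩
    rw [hf.1.natDegree_mul hg] at h2
    omega
  · intro g hg
    rw [mem_monicDeg] at hg
    exact (hΛ _ _ hf.1 hg.1).symm

open Classical in
theorem Lrec {p : ℕ} [Fact p.Prime] (Λ : (ZMod p)[X] → ℂ)
    (hΛ : ∀ f g, f.Monic → g.Monic → Λ (f * g) = Λ f * Λ g) (n : ℕ) :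
    (n : ℂ) * ∑ h ∈ monicDeg p n, Λ h =
      ∑ j ∈ Finset.Icc 1 n, (∑ x : GaloisField p j, Λ (cpoly p j x)) *
        ∑ g ∈ monicDeg p (n - j), Λ g := by
  calc (n : ℂ) * ∑ h ∈ monicDeg p n, Λ h
      = ∑ h ∈ monicDeg p n, ∑ j ∈ Finset.Icc 1 n, ∑ x : GaloisField p j,
          if cpoly p j x ∣ h then Λ h else 0 := by
        rw [Finset.mul_sum]
        refine Finset.sum_congr rfl fun h hh => ?_
        rw [mem_monicDeg] at hh
        conv_lhs => rw [← count_cpoly_dvd hh.1 hh.2]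
        rw [Nat.cast_sum, Finset.sum_mul]
        refine Finset.sum_congr rfl fun j _ => ?_
        rw [← Finset.sum_filter, Finset.sum_const, nsmul_eq_mul]
    _ = ∑ j ∈ Finset.Icc 1 n, ∑ x : GaloisField p j, ∑ h ∈ monicDeg p n,
          if cpoly p j x ∣ h then Λ h else 0 := by
        rw [Finset.sum_comm]
        refine Finset.sum_congr rfl fun j _ => ?_
        rw [Finset.sum_comm]
    _ = _ := by
        refine Finset.sum_congr rfl fun j hj => ?_
        rw [Finset.mem_Icc] at hj
        rw [Finset.sum_mul]
        refine Finset.sum_congr rfl fun x _ => ?_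
        rw [← Finset.sum_filter, sum_monicDeg_mul Λ hΛ hj.2 (cpoly_mem (by omega) x)]

end LRec

section Lam

open Polynomial

theorem minpoly_sub {F K : Type*} [Field F] [Field K] [Algebra F K] (x : K) (s : F) :
    minpoly F (x - algebraMap F K s) = (minpoly F x).comp (X + C s) := by
  have := minpoly.add_algebraMap (A := F) x (-s)
  simpa [sub_eq_add_neg] using this

theorem adjoin_inv {F K : Type*} [Field F] [Field K] [Algebra F K] (z : K) :
    IntermediateField.adjoin F {z⁻¹} = IntermediateField.adjoin F {z} := by
  apply le_antisymm
  · rw [IntermediateField.adjoin_simple_le_iff]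
    exact inv_mem (IntermediateField.mem_adjoin_simple_self F z)
  · rw [IntermediateField.adjoin_simple_le_iff]
    have := inv_mem (IntermediateField.mem_adjoin_simple_self F z⁻¹)
    rwa [inv_inv] at this

theorem minpoly_inv_nextCoeff {F K : Type*} [Field F] [Field K] [Algebra F K]
    [FiniteDimensional F K] {z : K} (hz : z ≠ 0) :
    (minpoly F z⁻¹).nextCoeff = (minpoly F z).coeff 1 / (minpoly F z).coeff 0 := by
  have hzi : IsIntegral F z := IsIntegral.of_finite _ _
  have hzi' : IsIntegral F z⁻¹ := IsIntegral.of_finite _ _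
  set P := minpoly F z with hP
  have hPm : P.Monic := minpoly.monic hzi
  have h0 : P.coeff 0 ≠ 0 := minpoly.coeff_zero_ne_zero hzi hz
  have hd : (minpoly F z⁻¹).natDegree = P.natDegree := by
    rw [← IntermediateField.adjoin.finrank hzi', adjoin_inv, IntermediateField.adjoin.finrank hzi]
  have hdp : 0 < P.natDegree := minpoly.natDegree_pos hzi
  set Q := C (P.coeff 0)⁻¹ * P.reverse with hQ
  have htr : P.natTrailingDegree = 0 := natTrailingDegree_eq_zero.mpr (Or.inr h0)
  have hQd : Q.natDegree = P.natDegree := by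
    rw [hQ, natDegree_C_mul (inv_ne_zero h0), reverse_natDegree, htr, Nat.sub_zero]
  have hQm : Q.Monic := by
    rw [Monic, hQ, leadingCoeff_mul, leadingCoeff_C, reverse_leadingCoeff, trailingCoeff, htr,
      inv_mul_cancel₀ h0]
  have hQ0 : aeval z⁻¹ Q = 0 := by
    have : Invertible z := invertibleOfNonzero hz
    have h := eval₂_reverse_mul_pow (algebraMap F K) z P
    have h2 : eval₂ (algebraMap F K) z P = 0 := minpoly.aeval F z
    rw [h2, invOf_eq_inv] at h
    rw [hQ, map_mul]
    rw [aeval_def z⁻¹ P.reverse]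
    rcases mul_eq_zero.mp h with h | h
    · rw [h, mul_zero]
    · exact absurd h (pow_ne_zero _ hz)
  have heq : minpoly F z⁻¹ = Q :=
    (eq_of_monic_of_dvd_of_natDegree_le (minpoly.monic hzi') hQm (minpoly.dvd F _ hQ0)
      (by rw [hd, hQd])).symm
  rw [heq, nextCoeff_of_natDegree_pos (by omega), hQd, hQ, coeff_C_mul, coeff_reverse,
    revAt_le (by omega)]
  have : P.natDegree - (P.natDegree - 1) = 1 := by omega
  rw [this]
  field_simp

theorem trace_inv_sub {F K : Type*} [Field F] [Field K] [Algebra F K]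
    [FiniteDimensional F K] (x : K) (s : F) (hx : x ≠ algebraMap F K s) :
    Algebra.trace F K (x - algebraMap F K s)⁻¹ =
      (Module.finrank (IntermediateField.adjoin F {x}) K : F) *
        -((minpoly F x).derivative.eval s / (minpoly F x).eval s) := by
  have hz : x - algebraMap F K s ≠ 0 := sub_ne_zero.mpr hx
  rw [trace_eq_finrank_mul_minpoly_nextCoeff, minpoly_inv_nextCoeff hz, minpoly_sub]
  have h1 : IntermediateField.adjoin F {(x - algebraMap F K s)⁻¹} =
      IntermediateField.adjoin F {x} := by
    rw [adjoin_inv]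
    apply le_antisymm
    · rw [IntermediateField.adjoin_simple_le_iff]
      exact sub_mem (IntermediateField.mem_adjoin_simple_self F x)
        (IntermediateField.algebraMap_mem _ s)
    · rw [IntermediateField.adjoin_simple_le_iff]
      have := add_mem (IntermediateField.mem_adjoin_simple_self F (x - algebraMap F K s))
        (IntermediateField.algebraMap_mem _ s)
      rwa [sub_add_cancel] at this
  rw [h1]
  congr 3
  · rw [← zero_add 1]
    have := coeff_derivative ((minpoly F x).comp (X + C s)) 0
    simp only [Nat.cast_zero, zero_add, mul_one] at this
    rw [zero_add, ← this, coeff_zero_eq_eval_zero, derivative_comp]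
    simp
  · rw [coeff_zero_eq_eval_zero]
    simp

/-- The multiplicative function on monic polynomials attached to a rational function. -/
noncomputable def Lam {p : ℕ} [Fact p.Prime] (ψ : AddChar (ZMod p) ℂ) (a b c s1 s2 : ZMod p)
    (h : (ZMod p)[X]) : ℂ :=
  if h.eval s1 = 0 ∨ h.eval s2 = 0 then 0 else
    ψ (-(a * h.nextCoeff) - b * (h.derivative.eval s1 / h.eval s1)
      - c * (h.derivative.eval s2 / h.eval s2))

theorem Lam_one {p : ℕ} [Fact p.Prime] (ψ : AddChar (ZMod p) ℂ) (a b c s1 s2 : ZMod p) :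
    Lam ψ a b c s1 s2 1 = 1 := by
  simp [Lam, nextCoeff]

theorem Lam_mul {p : ℕ} [Fact p.Prime] (ψ : AddChar (ZMod p) ℂ) (a b c s1 s2 : ZMod p)
    (f g : (ZMod p)[X]) (hf : f.Monic) (hg : g.Monic) :
    Lam ψ a b c s1 s2 (f * g) = Lam ψ a b c s1 s2 f * Lam ψ a b c s1 s2 g := by
  unfold Lam
  by_cases h1 : f.eval s1 = 0
  · simp [h1]
  by_cases h2 : f.eval s2 = 0
  · simp [h2]
  by_cases h3 : g.eval s1 = 0
  · simp [h3]
  by_cases h4 : g.eval s2 = 0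
  · simp [h4]
  simp only [eval_mul, h1, h2, h3, h4, mul_eq_zero, or_self, if_false]
  rw [← AddChar.map_add_eq_mul, hf.nextCoeff_mul hg]
  congr 1
  simp only [derivative_mul, eval_add, eval_mul]
  field_simp
  ring

theorem Lam_pow {p : ℕ} [Fact p.Prime] (ψ : AddChar (ZMod p) ℂ) (a b c s1 s2 : ZMod p)
    (f : (ZMod p)[X]) (hf : f.Monic) (k : ℕ) :
    Lam ψ a b c s1 s2 (f ^ k) = Lam ψ a b c s1 s2 f ^ k := by
  induction k with
  | zero => simp [Lam_one]
  | succ k ih => rw [pow_succ, Lam_mul _ _ _ _ _ _ _ _ (hf.pow k) hf, ih, pow_succ]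

theorem minpoly_eval_eq_zero_iff {F K : Type*} [Field F] [Field K] [Algebra F K]
    [FiniteDimensional F K] (x : K) (s : F) :
    (minpoly F x).eval s = 0 ↔ x = algebraMap F K s := by
  constructor
  · intro h
    have h1 : X - C s ∣ minpoly F x := dvd_iff_isRoot.mpr h
    have h2 := (minpoly.irreducible (IsIntegral.of_finite F x))
    have h3 := eq_of_monic_of_associated (monic_X_sub_C s)
      (minpoly.monic (IsIntegral.of_finite F x))
      ((irreducible_X_sub_C s).associated_of_dvd h2 h1)
    have h4 := minpoly.aeval F x
    rw [← h3] at h4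
    simpa [sub_eq_zero] using h4
  · rintro rfl
    rw [minpoly.eq_X_sub_C]
    simp

open Classical in
theorem Lam_cpoly {p : ℕ} [Fact p.Prime] (ψ : AddChar (ZMod p) ℂ) (a b c s1 s2 : ZMod p)
    {j : ℕ} (hj : j ≠ 0) (x : GaloisField p j) :
    Lam ψ a b c s1 s2 (cpoly p j x) =
      if x = algebraMap _ _ s1 ∨ x = algebraMap _ _ s2 then 0 else
        ψ (Algebra.trace (ZMod p) (GaloisField p j) (a • x + b • (x - algebraMap _ _ s1)⁻¹
          + c • (x - algebraMap _ _ s2)⁻¹)) := by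
  have hxi := gf_integral x
  rw [cpoly, Lam_pow _ _ _ _ _ _ _ (minpoly.monic hxi)]
  have hdvd := gf_minpoly_dvd hj x
  have hdp := minpoly.natDegree_pos hxi
  set k := j / (minpoly (ZMod p) x).natDegree with hk
  have hk0 : k ≠ 0 := by
    have := Nat.div_pos (Nat.le_of_dvd (Nat.pos_of_ne_zero hj) hdvd) hdp
    omega
  have hkf : Module.finrank (IntermediateField.adjoin (ZMod p) {x}) (GaloisField p j) = k := by
    have h1 := Module.finrank_mul_finrank (ZMod p) (IntermediateField.adjoin (ZMod p) {x})
      (GaloisField p j)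
    rw [GaloisField.finrank p hj, IntermediateField.adjoin.finrank hxi] at h1
    exact (Nat.div_eq_of_eq_mul_right hdp h1.symm).symm
  unfold Lam
  simp only [minpoly_eval_eq_zero_iff]
  split_ifs with h
  · exact zero_pow hk0
  · push Not at h
    rw [← AddChar.map_nsmul_eq_pow]
    congr 1
    rw [map_add, map_add, map_smul, map_smul, map_smul, trace_inv_sub x s1 h.1,
      trace_inv_sub x s2 h.2, trace_eq_finrank_mul_minpoly_nextCoeff, hkf]
    simp only [smul_eq_mul, nsmul_eq_mul]
    ring

theorem sum_Lam_eq_zero {p : ℕ} [Fact p.Prime] (ψ : AddChar (ZMod p) ℂ) (hψ : ψ.IsPrimitive)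
    (a b c s1 s2 : ZMod p) (hs : s1 ≠ s2) (hb : b ≠ 0) {d : ℕ} (hd : 5 ≤ d) :
    ∑ h ∈ monicDeg p d, Lam ψ a b c s1 s2 h = 0 := by
  set E : (ZMod p)[X] := C (((s1 - s2) ^ 2)⁻¹) * ((X - C s1) * (X - C s2) ^ 2) with hE
  have hss : s1 - s2 ≠ 0 := sub_ne_zero.mpr hs
  have hE1 : E.eval s1 = 0 := by simp [hE]
  have hE2 : E.eval s2 = 0 := by simp [hE]
  have hE1' : E.derivative.eval s1 = 1 := by
    simp only [hE, derivative_mul, derivative_C, derivative_sub, derivative_X, derivative_pow,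
      eval_add, eval_mul, eval_C, eval_sub, eval_X, eval_pow, sub_self, zero_mul, sub_zero,
      one_mul, add_zero, zero_add, mul_zero, eval_one]
    exact inv_mul_cancel₀ (pow_ne_zero _ hss)
  have hE2' : E.derivative.eval s2 = 0 := by
    simp [hE, derivative_mul, derivative_pow]
  have hEd : E.natDegree ≤ 3 := by
    rw [hE]
    compute_degree
  have hmem : ∀ t : ZMod p, ∀ h ∈ monicDeg p d, h + C t * E ∈ monicDeg p d := by
    intro t h hh
    rw [mem_monicDeg] at hh ⊢
    have hlt : (C t * E).degree < h.degree := by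
      rw [degree_eq_natDegree hh.1.ne_zero, hh.2]
      refine lt_of_le_of_lt (degree_le_of_natDegree_le ((natDegree_C_mul_le _ _).trans hEd)) ?_
      exact_mod_cast (by omega : 3 < d)
    exact ⟨hh.1.add_of_left hlt, by rw [natDegree_add_eq_left_of_degree_lt hlt, hh.2]⟩
  have hshift : ∀ t : ZMod p, ∑ h ∈ monicDeg p d, Lam ψ a b c s1 s2 (h + C t * E) =
      ∑ h ∈ monicDeg p d, Lam ψ a b c s1 s2 h := by
    intro t
    refine Finset.sum_nbij' (fun h => h + C t * E) (fun h => h + C (-t) * E) (hmem t) (hmem (-t))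
      ?_ ?_ ?_
    · intro h _
      simp
    · intro h _
      simp
    · intro h _
      rfl
  have hval : ∀ t : ZMod p, ∀ h ∈ monicDeg p d, Lam ψ a b c s1 s2 (h + C t * E) =
      Lam ψ a b c s1 s2 h * ψ (t * (-(b / h.eval s1))) := by
    intro t h hh
    have hh2 := hmem t h hh
    rw [mem_monicDeg] at hh hh2
    unfold Lam
    simp only [eval_add, eval_mul, hE1, hE2, mul_zero, add_zero, eval_C]
    split_ifs with h0
    · rw [zero_mul]
    · push Not at h0
      rw [← AddChar.map_add_eq_mul]
      congr 1
      have hnc : (h + C t * E).nextCoeff = h.nextCoeff := by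
        rw [nextCoeff_of_natDegree_pos (by omega), nextCoeff_of_natDegree_pos (by omega), hh.2,
          hh2.2, coeff_add, coeff_C_mul, coeff_eq_zero_of_natDegree_lt (by omega : E.natDegree < d - 1)]
        ring
      rw [hnc]
      simp only [derivative_add, derivative_mul, derivative_C, eval_add, eval_mul, eval_C, hE1',
        hE2', eval_zero, zero_mul, zero_add, mul_zero, add_zero, mul_one]
      have h01 := h0.1
      field_simp
      ring
  have hsum : (p : ℂ) * ∑ h ∈ monicDeg p d, Lam ψ a b c s1 s2 h = 0 := by
    calc (p : ℂ) * ∑ h ∈ monicDeg p d, Lam ψ a b c s1 s2 h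
        = ∑ t : ZMod p, ∑ h ∈ monicDeg p d, Lam ψ a b c s1 s2 (h + C t * E) := by
          simp only [hshift, Finset.sum_const, Finset.card_univ, ZMod.card, nsmul_eq_mul]
      _ = ∑ h ∈ monicDeg p d, ∑ t : ZMod p,
            Lam ψ a b c s1 s2 h * ψ (t * (-(b / h.eval s1))) := by
          rw [Finset.sum_comm]
          exact Finset.sum_congr rfl fun h hh => Finset.sum_congr rfl fun t _ => hval t h hh
      _ = 0 := by
          refine Finset.sum_eq_zero fun h _ => ?_
          rw [← Finset.mul_sum]
          by_cases h0 : h.eval s1 = 0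
          · simp [Lam, h0]
          · rw [AddChar.sum_mulShift _ hψ, if_neg (by
              rw [neg_eq_zero]
              exact div_ne_zero hb h0)]
            simp
  rcases mul_eq_zero.mp hsum with h | h
  · exact absurd (by exact_mod_cast h) (Fact.out : p.Prime).ne_zero
  · exact h

end Lam

section LBound

open Polynomial Filter Topology

theorem poly_nonvanish {P : ℂ[X]} (hP0 : P ≠ 0) {G : ℂ → ℂ} {ρ : ℝ}
    (hG : ∀ T : ℂ, ‖T‖ < ρ → P.derivative.eval T = G T * P.eval T)
    (hGb : ∀ r < ρ, ∃ M, ∀ T : ℂ, ‖T‖ ≤ r → ‖G T‖ ≤ M)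
    (T₀ : ℂ) (hT : ‖T₀‖ < ρ) : P.eval T₀ ≠ 0 := by
  intro h0
  obtain ⟨P1, hP1, hnd⟩ := Polynomial.exists_eq_pow_rootMultiplicity_mul_and_not_dvd P hP0 T₀
  set m := P.rootMultiplicity T₀ with hm
  have hmpos : 0 < m := (Polynomial.rootMultiplicity_pos hP0).mpr h0
  have hP1e : P1.eval T₀ ≠ 0 := fun h => hnd (Polynomial.dvd_iff_isRoot.mpr h)
  obtain ⟨k, hk⟩ : ∃ k, m = k + 1 := ⟨m - 1, by omega⟩
  obtain ⟨r, hr1, hr2⟩ := exists_between hT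
  obtain ⟨M, hM⟩ := hGb r hr2
  have hev : ∀ᶠ T in 𝓝[≠] T₀, (m : ℂ) * P1.eval T + (T - T₀) * P1.derivative.eval T =
      (T - T₀) * G T * P1.eval T := by
    have h1 : ∀ᶠ T in 𝓝[≠] T₀, ‖T‖ < ρ :=
      nhdsWithin_le_nhds ((continuous_norm.tendsto T₀).eventually_lt_const hT)
    filter_upwards [h1, self_mem_nhdsWithin] with T hT1 hT2
    have hne : T - T₀ ≠ 0 := sub_ne_zero.mpr hT2
    have h := hG T hT1
    rw [hP1, hk] at h
    simp only [derivative_mul, derivative_pow, derivative_sub, derivative_X, derivative_C,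
      eval_add, eval_mul, eval_pow, eval_sub, eval_X, eval_C, sub_zero, mul_one,
      Nat.add_sub_cancel, eval_natCast, eval_one] at h
    have h3 : (T - T₀) ^ k ≠ 0 := pow_ne_zero _ hne
    apply mul_left_cancel₀ h3
    rw [hk]
    rw [pow_succ] at h
    linear_combination h
  have hlim1 : Tendsto (fun T => (m : ℂ) * P1.eval T + (T - T₀) * P1.derivative.eval T)
      (𝓝[≠] T₀) (𝓝 ((m : ℂ) * P1.eval T₀)) := by
    have : Continuous fun T => (m : ℂ) * P1.eval T + (T - T₀) * P1.derivative.eval T := by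
      fun_prop
    have h := this.tendsto T₀
    simp only [sub_self, zero_mul, add_zero] at h
    exact h.mono_left nhdsWithin_le_nhds
  have hlim2 : Tendsto (fun T => (T - T₀) * G T * P1.eval T) (𝓝[≠] T₀) (𝓝 0) := by
    have h1 : Tendsto (fun T : ℂ => ‖T - T₀‖ * M * ‖P1.eval T‖) (𝓝[≠] T₀) (𝓝 0) := by
      have : Continuous fun T : ℂ => ‖T - T₀‖ * M * ‖P1.eval T‖ := by fun_prop
      have h := this.tendsto T₀
      simp only [sub_self, norm_zero, zero_mul] at h
      exact h.mono_left nhdsWithin_le_nhds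
    refine squeeze_zero_norm' ?_ h1
    have h2 : ∀ᶠ T in 𝓝[≠] T₀, ‖T‖ < r :=
      nhdsWithin_le_nhds ((continuous_norm.tendsto T₀).eventually_lt_const hr1)
    filter_upwards [h2] with T hT1
    rw [norm_mul, norm_mul]
    gcongr
    exact hM T hT1.le
  have h := tendsto_nhds_unique (hlim1.congr' hev) hlim2
  rcases mul_eq_zero.mp h with h | h
  · have : m = 0 := by exact_mod_cast h
    omega
  · exact hP1e h

theorem Lbound (c L : ℕ → ℂ) (hc0 : c 0 = 1) (hc5 : ∀ d, 5 ≤ d → c d = 0)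
    (hrec : ∀ n : ℕ, (n : ℂ) * c n = ∑ j ∈ Finset.Icc 1 n, L j * c (n - j))
    (C0 R : ℝ) (hR : 0 < R) (hL : ∀ j, 1 ≤ j → ‖L j‖ ≤ C0 * R ^ j) : ‖L 1‖ ≤ 4 * R := by
  set P : ℂ[X] := ∑ d ∈ Finset.range 5, C (c d) * X ^ d with hP
  have hC0 : 0 ≤ C0 := by
    have h := (norm_nonneg _).trans (hL 1 le_rfl)
    rw [pow_one] at h
    exact nonneg_of_mul_nonneg_left h hR
  have hbd : ∀ T : ℂ, ∀ j, ‖L (j + 1) * T ^ j‖ ≤ C0 * R * (R * ‖T‖) ^ j := by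
    intro T j
    rw [norm_mul, norm_pow]
    calc _ ≤ C0 * R ^ (j + 1) * ‖T‖ ^ j := by
          gcongr
          exact hL _ (by omega)
      _ = _ := by rw [mul_pow]; ring
  have hlt : ∀ T : ℂ, ‖T‖ < 1 / R → R * ‖T‖ < 1 := by
    intro T hT
    rw [lt_div_iff₀ hR] at hT
    linarith
  have hsumG : ∀ T : ℂ, ‖T‖ < 1 / R → Summable fun j => ‖L (j + 1) * T ^ j‖ := by
    intro T hT
    refine Summable.of_nonneg_of_le (fun _ => norm_nonneg _) (hbd T) ?_
    exact (summable_geometric_of_lt_one (by positivity) (hlt T hT)).mul_left _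
  have hPe : ∀ T, P.eval T = ∑' n, c n * T ^ n := by
    intro T
    rw [tsum_eq_sum (s := Finset.range 5)]
    · simp [hP, eval_finset_sum]
    · intro n hn
      rw [Finset.mem_range, not_lt] at hn
      rw [hc5 n hn, zero_mul]
  have hPs : ∀ T : ℂ, Summable fun n => ‖c n * T ^ n‖ := by
    intro T
    refine summable_of_ne_finset_zero (s := Finset.range 5) ?_
    intro n hn
    rw [Finset.mem_range, not_lt] at hn
    rw [hc5 n hn, zero_mul, norm_zero]
  have hPd : ∀ T, P.derivative.eval T = ∑' n : ℕ, ((n + 1 : ℕ) : ℂ) * c (n + 1) * T ^ n := by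
    intro T
    rw [tsum_eq_sum (s := Finset.range 4)]
    · simp [hP, Finset.sum_range_succ]
      ring
    · intro n hn
      rw [Finset.mem_range, not_lt] at hn
      rw [hc5 (n + 1) (by omega), mul_zero, zero_mul]
  have hP0 : P ≠ 0 := by
    intro h
    have := hPe 0
    rw [h, eval_zero, tsum_eq_sum (s := {0})] at this
    · simp [hc0] at this
    · intro b hb
      simp at hb
      simp [hb]
  have hnv := poly_nonvanish (P := P) hP0 (G := fun T => ∑' j, L (j + 1) * T ^ j) (ρ := 1 / R)
    (by
      intro T hT
      rw [hPe, hPd, tsum_mul_tsum_eq_tsum_sum_range_of_summable_norm (hsumG T hT) (hPs T)]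
      refine tsum_congr fun n => ?_
      rw [hrec, Finset.sum_mul, Finset.sum_bij (fun j _ => j - 1)]
      · intro j hj
        rw [Finset.mem_Icc] at hj
        rw [Finset.mem_range]
        omega
      · intro a ha b hb hab
        rw [Finset.mem_Icc] at ha hb
        omega
      · intro b hb
        rw [Finset.mem_range] at hb
        exact ⟨b + 1, by rw [Finset.mem_Icc]; omega, by omega⟩
      · intro j hj
        rw [Finset.mem_Icc] at hj
        obtain ⟨k, rfl⟩ : ∃ k, j = k + 1 := ⟨j - 1, by omega⟩
        obtain ⟨l, rfl⟩ : ∃ l, n = k + l := ⟨n - k, by omega⟩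
        have e1 : k + l + 1 - (k + 1) = l := by omega
        have e2 : k + l - (k + 1 - 1) = l := by omega
        rw [e1, e2, Nat.add_sub_cancel, pow_add]
        ring)
    (by
      intro r hr
      by_cases hr0 : r < 0
      · refine ⟨0, fun T hT => ?_⟩
        have := norm_nonneg T
        linarith
      · push Not at hr0
        have hRr : R * r < 1 := by
          rw [lt_div_iff₀ hR] at hr
          linarith
        refine ⟨∑' j : ℕ, C0 * R * (R * r) ^ j, fun T hT => ?_⟩
        refine tsum_of_norm_bounded ((summable_geometric_of_lt_one (by positivity)
          hRr).mul_left _).hasSum (fun j => (hbd T j).trans ?_)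
        gcongr)
  set Q : ℂ[X] := X ^ 4 + (C (c 1) * X ^ 3 + C (c 2) * X ^ 2 + C (c 3) * X + C (c 4)) with hQ
  have hdlt : (C (c 1) * X ^ 3 + C (c 2) * X ^ 2 + C (c 3) * X + C (c 4)).degree < ((4 : ℕ) : WithBot ℕ) :=
    degree_cubic_lt
  have hQm : Q.Monic := monic_X_pow_add hdlt
  have hQd : Q.natDegree = 4 := by
    rw [hQ]
    compute_degree!
  have hQn : Q.nextCoeff = c 1 := by
    rw [nextCoeff_of_natDegree_pos (by omega), hQd]
    simp [hQ, coeff_X, coeff_C]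
  have hroot : ∀ α ∈ Q.roots, ‖α‖ ≤ R := by
    intro α hα
    by_contra hlt'
    push Not at hlt'
    have hα0 : α ≠ 0 := by
      rintro rfl
      rw [norm_zero] at hlt'
      linarith
    have he : Q.eval α = 0 := (mem_roots'.mp hα).2
    refine hnv α⁻¹ ?_ ?_
    · rw [norm_inv, one_div]
      exact inv_strictAnti₀ hR hlt'
    · have : P.eval α⁻¹ = Q.eval α / α ^ 4 := by
        simp [hP, hQ, Finset.sum_range_succ, hc0]
        field_simp
        ring
      rw [this, he, zero_div]
  have hL1 : L 1 = c 1 := by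
    have := hrec 1
    simp [hc0] at this
    exact this.symm
  have hv := (IsAlgClosed.splits Q).nextCoeff_eq_neg_sum_roots_of_monic hQm
  rw [hL1, ← hQn, hv, norm_neg]
  refine (norm_multiset_sum_le _).trans ?_
  refine (Multiset.sum_le_card_nsmul _ R ?_).trans ?_
  · intro x hx
    rw [Multiset.mem_map] at hx
    obtain ⟨α, hα, rfl⟩ := hx
    exact hroot α hα
  · rw [Multiset.card_map, nsmul_eq_mul]
    have : (Multiset.card Q.roots : ℝ) ≤ 4 := by
      have := Q.card_roots'
      rw [hQd] at this
      exact_mod_cast this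
    gcongr

end LBound


theorem add_hilbert90 {p : ℕ} [Fact p.Prime] {K : Type*} [Field K] [Fintype K]
    [Algebra (ZMod p) K] (z : K) (hz : Algebra.trace (ZMod p) K z = 0) :
    ∃ y : K, y ^ p - y = z := by
  have : CharP K p := charP_of_injective_algebraMap (algebraMap (ZMod p) K).injective p
  have : FiniteDimensional (ZMod p) K := inferInstance
  let φ : K →ₗ[ZMod p] K := (FiniteField.frobeniusAlgHom (ZMod p) K).toLinearMap - LinearMap.id
  have hφ : ∀ y, φ y = y ^ p - y := by
    intro y
    simp [φ, ZMod.card]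
  have h1 : Module.finrank (ZMod p) (LinearMap.ker φ) ≤ 1 := by
    have hle : LinearMap.ker φ ≤ Submodule.span (ZMod p) {(1 : K)} := by
      intro y hy
      rw [LinearMap.mem_ker, hφ, sub_eq_zero] at hy
      rw [← Subfield.mem_bot_iff_pow_eq_self K p, mem_bot_iff_intCast p K] at hy
      obtain ⟨n, rfl⟩ := hy
      rw [Submodule.mem_span_singleton]
      exact ⟨(n : ZMod p), by simp [Algebra.smul_def]⟩
    refine (Submodule.finrank_mono hle).trans ?_
    exact (finrank_span_singleton (one_ne_zero)).le
  have h2 := φ.finrank_range_add_finrank_ker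
  have h3 := (Algebra.trace (ZMod p) K).finrank_range_add_finrank_ker
  rw [LinearMap.range_eq_top.mpr (Algebra.trace_surjective (ZMod p) K), finrank_top,
    Module.finrank_self] at h3
  have h4 : LinearMap.range φ ≤ LinearMap.ker (Algebra.trace (ZMod p) K) := by
    rintro _ ⟨y, rfl⟩
    rw [LinearMap.mem_ker, hφ, map_sub, sub_eq_zero]
    apply (algebraMap (ZMod p) K).injective
    rw [FiniteField.algebraMap_trace_eq_sum_pow, FiniteField.algebraMap_trace_eq_sum_pow,
      Nat.card_zmod]
    have hsum : (∑ i ∈ Finset.range (Module.finrank (ZMod p) K), y ^ p ^ i) ^ p =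
        ∑ i ∈ Finset.range (Module.finrank (ZMod p) K), (y ^ p) ^ p ^ i := by
      rw [sum_pow_char]
      refine Finset.sum_congr rfl fun i _ => ?_
      rw [← pow_mul, ← pow_mul, mul_comm]
    rw [← hsum]
    have := FiniteField.algebraMap_trace_eq_sum_pow (ZMod p) K y
    rw [Nat.card_zmod] at this
    rw [← this, ← map_pow, ZMod.pow_card]
  have h5 := Submodule.eq_of_le_of_finrank_le h4 (by omega)
  have h6 : z ∈ LinearMap.range φ := by
    rw [h5]
    exact hz
  obtain ⟨y, hy⟩ := h6
  exact ⟨y, by rw [← hφ, hy]⟩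

section Weil

open Polynomial

theorem char_sum_bound {ι : Type*} [Fintype ι] (ψ : ι → ℂ) (hψ : ∀ t, ‖ψ t‖ ≤ 1)
    (hψ0 : ∑ t, ψ t = 0) (N : ι → ℝ) (Q M : ℝ) (hM : 0 ≤ M) (hN : ∀ t, N t ≤ Q + M)
    (hsum : Fintype.card ι * Q - 2 ≤ ∑ t, N t) :
    ‖∑ t, (N t : ℂ) * ψ t‖ ≤ 2 * Fintype.card ι * M + 2 := by
  have h1 : ∑ t, (N t : ℂ) * ψ t = ∑ t, ((N t - Q : ℝ) : ℂ) * ψ t := by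
    have : ∑ t, ((N t - Q : ℝ) : ℂ) * ψ t = ∑ t, (N t : ℂ) * ψ t - Q * ∑ t, ψ t := by
      rw [Finset.mul_sum, ← Finset.sum_sub_distrib]
      refine Finset.sum_congr rfl fun t _ => ?_
      push_cast
      ring
    rw [this, hψ0, mul_zero, sub_zero]
  rw [h1]
  calc ‖∑ t, ((N t - Q : ℝ) : ℂ) * ψ t‖ ≤ ∑ t, (2 * M - (N t - Q)) := by
        refine norm_sum_le_of_le _ fun t _ => ?_
        rw [norm_mul, Complex.norm_real, Real.norm_eq_abs]
        have h2 : |N t - Q| * ‖ψ t‖ ≤ |N t - Q| :=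
          mul_le_of_le_one_right (abs_nonneg _) (hψ t)
        have h3 := hN t
        rcases abs_cases (N t - Q) with h | h <;> linarith [h.1, h.2]
    _ = 2 * Fintype.card ι * M + (Fintype.card ι * Q - ∑ t, N t) := by
        rw [Finset.sum_sub_distrib, Finset.sum_sub_distrib]
        simp only [Finset.sum_const, Finset.card_univ, nsmul_eq_mul]
        ring
    _ ≤ _ := by linarith

theorem partial_fraction_aux {K : Type*} [Field K] (a b c γ x s1 s2 : K) (e1 : x - s1 ≠ 0)
    (e2 : x - s2 ≠ 0) : a * x + b * (x - s1)⁻¹ + c * (x - s2)⁻¹ - γ =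
      (a * x * ((x - s1) * (x - s2)) + b * (x - s2) + c * (x - s1) - γ * ((x - s1) * (x - s2))) /
        ((x - s1) * (x - s2)) := by
  field_simp

open Classical in
theorem fiber_bound {p : ℕ} [Fact p.Prime] {n : ℕ} (hn : n ≠ 0) (a b c s1 s2 : ZMod p)
    (ha : a ≠ 0) {G c' : ℕ} (hG : G = (2 * p + 1) * (p - 1)) (hc : c' = p * (G + 1) + 1)
    (hlarge : c' + G < p ^ (n / 2)) (t : ZMod p) :
    p * (Finset.univ.filter fun x : GaloisField p n =>
      ¬ (x = algebraMap _ _ s1 ∨ x = algebraMap _ _ s2) ∧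
        Algebra.trace (ZMod p) (GaloisField p n) (a • x + b • (x - algebraMap _ _ s1)⁻¹
          + c • (x - algebraMap _ _ s2)⁻¹) = t).card ≤
      p ^ n + p ^ (n / 2) * (2 * G + 1 + c') := by
  set K := GaloisField p n
  obtain ⟨γ, hγ⟩ := Algebra.trace_surjective (ZMod p) K t
  have hcard : Fintype.card K = p ^ (n - n / 2) * p ^ (n / 2) := by
    rw [← Nat.card_eq_fintype_card, GaloisField.card p n hn, ← pow_add]
    congr 1
    omega
  have h1 : p ^ (n - n / 2) * p ^ (n / 2) = p ^ n := by
    rw [← pow_add]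
    congr 1
    omega
  set σ1 : K := algebraMap _ _ s1
  set σ2 : K := algebraMap _ _ s2
  set a' : K := algebraMap _ _ a
  set b' : K := algebraMap _ _ b
  set d' : K := algebraMap _ _ c
  have ha' : a' ≠ 0 := by
    rw [Ne, map_eq_zero]
    exact ha
  have := stepanov_bound (K := K) (p := p) (μ := n - n / 2) (ν := n / 2) hcard
    (by
      rw [← pow_succ']
      exact Nat.pow_le_pow_right (Fact.out : p.Prime).pos (by omega)) hG hc hlarge
    ((X - C σ1) * (X - C σ2))
    (C a' * X * ((X - C σ1) * (X - C σ2)) + C b' * (X - C σ2) + C d' * (X - C σ1)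
      - C γ * ((X - C σ1) * (X - C σ2)))
    (by compute_degree!) (by compute_degree!)
    (Finset.univ.filter fun x : K =>
      ¬ (x = σ1 ∨ x = σ2) ∧
        Algebra.trace (ZMod p) K (a • x + b • (x - σ1)⁻¹ + c • (x - σ2)⁻¹) = t)
    (by
      intro x hx
      rw [Finset.mem_filter] at hx
      obtain ⟨-, hx1, hx2⟩ := hx
      push Not at hx1
      have e1 : x - σ1 ≠ 0 := sub_ne_zero.mpr hx1.1
      have e2 : x - σ2 ≠ 0 := sub_ne_zero.mpr hx1.2
      refine ⟨?_, ?_⟩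
      · simp [e1, e2]
      · obtain ⟨y, hy⟩ := add_hilbert90 (p := p)
          (a • x + b • (x - σ1)⁻¹ + c • (x - σ2)⁻¹ - γ) (by rw [map_sub, hx2, hγ, sub_self])
        refine ⟨y, ?_⟩
        rw [hy]
        simp only [Algebra.smul_def, eval_add, eval_mul, eval_sub, eval_X, eval_C]
        exact partial_fraction_aux a' b' d' γ x σ1 σ2 e1 e2)
  rw [h1] at this
  exact this

open Classical in
theorem weil_L_bound {p : ℕ} [Fact p.Prime] (ψ : AddChar (ZMod p) ℂ) (hψ : ψ.IsPrimitive)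
    (a b c s1 s2 : ZMod p) (ha : a ≠ 0) :
    ∃ C0 : ℝ, ∀ n : ℕ, 1 ≤ n → ‖∑ x : GaloisField p n, Lam ψ a b c s1 s2 (cpoly p n x)‖ ≤
      C0 * Real.sqrt p ^ n := by
  obtain ⟨G, hG⟩ : ∃ G, G = (2 * p + 1) * (p - 1) := ⟨_, rfl⟩
  obtain ⟨c', hc⟩ : ∃ c', c' = p * (G + 1) + 1 := ⟨_, rfl⟩
  have hp : p.Prime := Fact.out
  have hp1 : (1 : ℝ) ≤ p := by exact_mod_cast hp.one_lt.le
  have hsq : 1 ≤ Real.sqrt p := Real.one_le_sqrt.mpr hp1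
  have hψn : ∀ t, ‖ψ t‖ = 1 := fun t => AddChar.norm_apply ψ t
  refine ⟨max ((p : ℝ) ^ (2 * (c' + G))) (2 * p * (2 * G + 1 + c') + 2), fun n hn => ?_⟩
  have hn0 : n ≠ 0 := by omega
  have hcard : Fintype.card (GaloisField p n) = p ^ n := by
    rw [← Nat.card_eq_fintype_card, GaloisField.card p n hn0]
  have hsn : 1 ≤ Real.sqrt p ^ n := one_le_pow₀ hsq
  simp only [Lam_cpoly ψ a b c s1 s2 hn0]
  by_cases hlarge : c' + G < p ^ (n / 2)
  · set N : ZMod p → ℕ := fun t => (Finset.univ.filter fun x : GaloisField p n =>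
      ¬ (x = algebraMap _ _ s1 ∨ x = algebraMap _ _ s2) ∧
        Algebra.trace (ZMod p) (GaloisField p n) (a • x + b • (x - algebraMap _ _ s1)⁻¹
          + c • (x - algebraMap _ _ s2)⁻¹) = t).card with hN
    set U := Finset.univ.filter fun x : GaloisField p n =>
      ¬ (x = algebraMap _ _ s1 ∨ x = algebraMap _ _ s2) with hU
    have hsum : ∑ x : GaloisField p n, (if x = algebraMap _ _ s1 ∨ x = algebraMap _ _ s2 then 0 else
        ψ (Algebra.trace (ZMod p) (GaloisField p n) (a • x + b • (x - algebraMap _ _ s1)⁻¹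
          + c • (x - algebraMap _ _ s2)⁻¹))) = ∑ t, ((N t : ℝ) : ℂ) * ψ t := by
      have : ∀ x : GaloisField p n, (if x = algebraMap _ _ s1 ∨ x = algebraMap _ _ s2 then 0 else
        ψ (Algebra.trace (ZMod p) (GaloisField p n) (a • x + b • (x - algebraMap _ _ s1)⁻¹
          + c • (x - algebraMap _ _ s2)⁻¹))) =
          if ¬ (x = algebraMap _ _ s1 ∨ x = algebraMap _ _ s2) then
          ψ (Algebra.trace (ZMod p) (GaloisField p n) (a • x + b • (x - algebraMap _ _ s1)⁻¹
          + c • (x - algebraMap _ _ s2)⁻¹)) else 0 := fun x => by rw [ite_not]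
      simp only [this]
      rw [← Finset.sum_filter, ← hU, ← Finset.sum_fiberwise U
        (fun x => Algebra.trace (ZMod p) (GaloisField p n) (a • x + b • (x - algebraMap _ _ s1)⁻¹
          + c • (x - algebraMap _ _ s2)⁻¹))]
      refine Finset.sum_congr rfl fun t _ => ?_
      rw [Finset.sum_congr rfl (g := fun _ => ψ t)]
      · rw [Finset.sum_const, nsmul_eq_mul, hU, Finset.filter_filter]
        push_cast
        rfl
      · intro x hx
        rw [Finset.mem_filter] at hx
        rw [hx.2]
    have hNs : p ^ n ≤ ∑ t, N t + 2 := by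
      have h1 : ∑ t, N t = U.card := by
        rw [Finset.card_eq_sum_card_fiberwise (t := Finset.univ) (f := fun x =>
          Algebra.trace (ZMod p) (GaloisField p n) (a • x + b • (x - algebraMap _ _ s1)⁻¹
          + c • (x - algebraMap _ _ s2)⁻¹)) (fun _ _ => Finset.mem_coe.mpr (Finset.mem_univ _))]
        simp only [hN, hU, Finset.filter_filter]
      have h2 : (Finset.univ.filter fun x : GaloisField p n =>
          x = algebraMap _ _ s1 ∨ x = algebraMap _ _ s2).card + U.card =
          (Finset.univ : Finset (GaloisField p n)).card := by
        rw [hU]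
        convert Finset.card_filter_add_card_filter_not
          (s := (Finset.univ : Finset (GaloisField p n)))
          (fun x => x = algebraMap _ _ s1 ∨ x = algebraMap _ _ s2)
      have h3 : (Finset.univ.filter fun x : GaloisField p n =>
          x = algebraMap _ _ s1 ∨ x = algebraMap _ _ s2).card ≤ 2 := by
        have : (Finset.univ.filter fun x : GaloisField p n =>
          x = algebraMap _ _ s1 ∨ x = algebraMap _ _ s2) ⊆ {algebraMap _ _ s1, algebraMap _ _ s2} := by
          intro x
          simp
        exact (Finset.card_le_card this).trans Finset.card_le_two
      rw [Finset.card_univ, hcard] at h2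
      rw [h1]
      omega
    rw [hsum]
    have hpn : (p : ℝ) ^ (n / 2) ≤ Real.sqrt p ^ n := by
      calc (p : ℝ) ^ (n / 2) = Real.sqrt p ^ (2 * (n / 2)) := by
            rw [pow_mul, Real.sq_sqrt (by positivity)]
        _ ≤ _ := pow_le_pow_right₀ hsq (by omega)
    have hb := char_sum_bound (fun t => ψ t) (fun t => (hψn t).le)
      (by
        have := AddChar.sum_eq_zero_of_ne_one (ψ := ψ) (by
          have := hψ one_ne_zero
          rwa [AddChar.mulShift_one] at this)
        exact this)
      (fun t => (N t : ℝ)) ((p : ℝ) ^ n / p) ((p : ℝ) ^ (n / 2) * (2 * G + 1 + c'))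
      (by positivity)
      (by
        intro t
        have h1 := fiber_bound hn0 a b c s1 s2 ha hG hc hlarge t
        have h2 : (p : ℝ) * N t ≤ (p : ℝ) ^ n + (p : ℝ) ^ (n / 2) * (2 * G + 1 + c') := by
          exact_mod_cast h1
        have hp0 : (0 : ℝ) < p := by linarith
        rw [← mul_le_mul_iff_right₀ hp0]
        refine h2.trans ?_
        have h3 : (0 : ℝ) ≤ (p : ℝ) ^ (n / 2) * (2 * G + 1 + c') := by positivity
        generalize (p : ℝ) ^ (n / 2) * (2 * G + 1 + c') = Y at h3
        rw [mul_add, mul_div_cancel₀ _ hp0.ne']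
        nlinarith)
      (by
        rw [ZMod.card, mul_div_cancel₀ _ (by linarith : (0 : ℝ) < p).ne']
        have : ((p ^ n : ℕ) : ℝ) ≤ ((∑ t, N t + 2 : ℕ) : ℝ) := by exact_mod_cast hNs
        push_cast at this
        linarith)
    refine hb.trans ?_
    rw [ZMod.card]
    calc 2 * (p : ℝ) * ((p : ℝ) ^ (n / 2) * (2 * G + 1 + c')) + 2
        ≤ 2 * (p : ℝ) * (Real.sqrt p ^ n * (2 * G + 1 + c')) + 2 * Real.sqrt p ^ n := by
          gcongr
          linarith
      _ = (2 * p * (2 * G + 1 + c') + 2) * Real.sqrt p ^ n := by ring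
      _ ≤ _ := by
          gcongr
          exact le_max_right _ _
  · have hsmall : n ≤ 2 * (c' + G) := by
      by_contra h
      have h1 : c' + G ≤ n / 2 := by omega
      have h2 : n / 2 < p ^ (n / 2) := Nat.lt_pow_self hp.one_lt
      omega
    calc _ ≤ ∑ x : GaloisField p n, (1 : ℝ) := by
          refine norm_sum_le_of_le _ fun x _ => ?_
          split_ifs
          · simp
          · exact (hψn _).le
      _ = (p : ℝ) ^ n := by
          rw [Finset.sum_const, Finset.card_univ, hcard]
          simp
      _ ≤ (p : ℝ) ^ (2 * (c' + G)) * 1 := by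
          rw [mul_one]
          exact pow_le_pow_right₀ hp1 hsmall
      _ ≤ _ := by
          gcongr
          exact le_max_left _ _

theorem weil_sum_bound {p : ℕ} [Fact p.Prime] (ψ : AddChar (ZMod p) ℂ) (hψ : ψ.IsPrimitive)
    (a b c s1 s2 : ZMod p) (ha : a ≠ 0) (hb : b ≠ 0) (hs : s1 ≠ s2) :
    ‖∑ x ∈ Finset.univ.filter (fun x : ZMod p => x ≠ s1 ∧ x ≠ s2),
      ψ (a * x + b / (x - s1) + c / (x - s2))‖ ≤ 4 * Real.sqrt p := by
  classical
  obtain ⟨C0, hC0⟩ := weil_L_bound ψ hψ a b c s1 s2 ha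
  have hp : (0 : ℝ) < p := by exact_mod_cast (Fact.out : p.Prime).pos
  have h := Lbound (fun n => ∑ h ∈ monicDeg p n, Lam ψ a b c s1 s2 h)
    (fun n => ∑ x : GaloisField p n, Lam ψ a b c s1 s2 (cpoly p n x))
    (by
      have : monicDeg p 0 = {1} := by
        ext h
        rw [mem_monicDeg, Finset.mem_singleton]
        constructor
        · rintro ⟨h1, h2⟩
          exact (Monic.natDegree_eq_zero h1).mp h2
        · rintro rfl
          simp
      simp only [this, Finset.sum_singleton, Lam_one])
    (fun d hd => sum_Lam_eq_zero ψ hψ a b c s1 s2 hs hb hd)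
    (fun n => Lrec _ (Lam_mul ψ a b c s1 s2) n) C0 (Real.sqrt p) (Real.sqrt_pos.mpr hp) hC0
  convert h using 2
  simp only [Lam_cpoly ψ a b c s1 s2 one_ne_zero]
  rw [Finset.sum_filter]
  have hbij : Function.Bijective (algebraMap (ZMod p) (GaloisField p 1)) :=
    (GaloisField.equivZmodP p).symm.bijective.comp Function.bijective_id |> fun h => by
      convert h
      ext x
      simp
  refine Fintype.sum_bijective _ hbij _ _ fun x => ?_
  by_cases hx : x = s1 ∨ x = s2
  · rw [if_neg (by tauto), if_pos (by rcases hx with rfl | rfl <;> simp)]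
  · rw [if_pos (by tauto), if_neg (by
      simpa only [hbij.injective.eq_iff] using hx)]
    congr 1
    have : a • algebraMap (ZMod p) (GaloisField p 1) x +
        b • (algebraMap (ZMod p) (GaloisField p 1) x - algebraMap _ _ s1)⁻¹ +
        c • (algebraMap (ZMod p) (GaloisField p 1) x - algebraMap _ _ s2)⁻¹ =
        algebraMap (ZMod p) (GaloisField p 1) (a * x + b / (x - s1) + c / (x - s2)) := by
      simp [Algebra.smul_def, div_eq_mul_inv]
    rw [this, Algebra.trace_algebraMap, GaloisField.finrank p one_ne_zero, one_smul]

end Weil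

section Cubes

theorem cube_inj {p : ℕ} [Fact p.Prime] (hp3 : p % 3 = 2) {x y : ZMod p} (h : x ^ 3 = y ^ 3) :
    x = y := by
  have key : ∀ z : ZMod p, (z ^ 3) ^ (2 * (p / 3) + 1) = z := by
    intro z
    have hp : p.Prime := Fact.out
    rw [← pow_mul]
    have e : 3 * (2 * (p / 3) + 1) = p + (p - 1) := by omega
    rw [e, pow_add, ZMod.pow_card]
    by_cases hz : z = 0
    · simp [hz]
    · rw [ZMod.pow_card_sub_one_eq_one hz, mul_one]
  rw [← key x, h, key]

theorem cube_surj {p : ℕ} [Fact p.Prime] (hp3 : p % 3 = 2) (y : ZMod p) :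
    ∃ x : ZMod p, x ^ 3 = y :=
  Finite.surjective_of_injective (f := fun x : ZMod p => x ^ 3) (fun _ _ h => cube_inj hp3 h) y

theorem nsEps_spec {p : ℕ} [Fact p.Prime] (hp2 : p ≠ 2) : ∀ x : ZMod p, x ^ 2 ≠ nsEps p := by
  have hne : {n : ℕ | 0 < n ∧ ¬∃ x : ZMod p, x ^ 2 = (n : ZMod p)}.Nonempty := by
    obtain ⟨a, ha⟩ := FiniteField.exists_nonsquare (F := ZMod p) (by
      rwa [ZMod.ringChar_zmod_n])
    refine ⟨a.val, ?_, ?_⟩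
    · rcases Nat.eq_zero_or_pos a.val with h | h
      · rw [ZMod.val_eq_zero] at h
        subst h
        exact absurd IsSquare.zero ha
      · exact h
    · rintro ⟨x, hx⟩
      apply ha
      refine ⟨x, ?_⟩
      rw [ZMod.natCast_zmod_val] at hx
      rw [← hx, sq]
  intro x hx
  exact (Nat.sInf_mem hne).2 ⟨x, hx⟩

theorem small_ne_zero {p : ℕ} [Fact p.Prime] (hp3 : p % 3 = 2) (hp2 : p ≠ 2) :
    (2 : ZMod p) ≠ 0 ∧ (3 : ZMod p) ≠ 0 := by
  have hp : p.Prime := Fact.out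
  constructor
  · intro h
    have h2 : ((2 : ℕ) : ZMod p) = 0 := by exact_mod_cast h
    rw [ZMod.natCast_eq_zero_iff] at h2
    exact hp2 ((Nat.prime_dvd_prime_iff_eq hp Nat.prime_two).mp h2)
  · intro h
    have h2 : ((3 : ℕ) : ZMod p) = 0 := by exact_mod_cast h
    rw [ZMod.natCast_eq_zero_iff] at h2
    have := (Nat.prime_dvd_prime_iff_eq hp Nat.prime_three).mp h2
    omega

theorem neg_three_nonsquare {p : ℕ} [Fact p.Prime] (hp3 : p % 3 = 2) (hp2 : p ≠ 2) :
    ¬ IsSquare (-3 : ZMod p) := by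
  obtain ⟨h2, h3⟩ := small_ne_zero hp3 hp2
  rintro ⟨w, hw⟩
  have h1 : (-1 + w) ^ 3 = 2 ^ 3 := by linear_combination (-w + 3) * hw
  have h4 := cube_inj hp3 h1
  have h5 : w = 3 := by linear_combination h4
  rw [h5] at hw
  have h6 : (2 : ZMod p) ^ 2 * 3 = 0 := by linear_combination -hw
  rcases mul_eq_zero.mp h6 with h | h
  · exact h2 (pow_eq_zero_iff two_ne_zero |>.mp h)
  · exact h3 h

theorem exists_sigma {p : ℕ} [Fact p.Prime] (hp3 : p % 3 = 2) (hp2 : p ≠ 2) {ε : ZMod p}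
    (hε : ∀ x : ZMod p, x ^ 2 ≠ ε) : ∃ σ : ZMod p, ε * σ ^ 2 = -3 := by
  have h3 := (small_ne_zero hp3 hp2).2
  have hε0 : ε ≠ 0 := fun h => hε 0 (by rw [h]; ring)
  have hsq : IsSquare (-3 * ε) := by
    rw [← quadraticChar_one_iff_isSquare (mul_ne_zero (neg_ne_zero.mpr h3) hε0), map_mul,
      quadraticChar_neg_one_iff_not_isSquare.mpr (neg_three_nonsquare hp3 hp2),
      quadraticChar_neg_one_iff_not_isSquare.mpr (by
        rintro ⟨x, hx⟩
        exact hε x (by rw [hx, sq]))]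
    norm_num
  obtain ⟨w, hw⟩ := hsq
  refine ⟨w / ε, ?_⟩
  field_simp
  linear_combination -hw

/-- Membership in `Ocubes` in coordinates. -/
theorem mem_Ocubes_iff {p : ℕ} [Fact p.Prime] {r : GaloisField p 2} {ε : ZMod p}
    (hr : r ^ 2 = algebraMap (ZMod p) (GaloisField p 2) ε) (hε : ∀ x : ZMod p, x ^ 2 ≠ ε)
    (a b : ZMod p) : (a, b) ∈ Ocubes p r ↔ (a, b) ≠ 0 ∧
      ∃ u v : ZMod p, a = u ^ 3 + 3 * ε * u * v ^ 2 ∧ b = 3 * u ^ 2 * v + ε * v ^ 3 := by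
  set φ := algebraMap (ZMod p) (GaloisField p 2) with hφ
  have hinj : Function.Injective φ := φ.injective
  have hind : ∀ a b : ZMod p, φ a + φ b * r = 0 → a = 0 ∧ b = 0 := by
    intro a b h
    have hb : b = 0 := by
      by_contra hb
      apply hε (a / b)
      apply hinj
      rw [← hr, map_pow, map_div₀]
      have hb' : φ b ≠ 0 := by rwa [Ne, map_eq_zero]
      have : r = -(φ a / φ b) := by
        rw [eq_neg_iff_add_eq_zero, ← mul_right_inj' hb', mul_zero, mul_add, mul_div_cancel₀ _ hb']
        linear_combination h
      rw [this]
      ring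
    refine ⟨?_, hb⟩
    rw [hb, map_zero, zero_mul, add_zero] at h
    rwa [map_eq_zero] at h
  have hinj2 : Function.Injective fun x : ZMod p × ZMod p => φ x.1 + φ x.2 * r := by
    rintro ⟨a, b⟩ ⟨a', b'⟩ h
    simp only at h
    have := hind (a - a') (b - b') (by rw [map_sub, map_sub]; linear_combination h)
    ext
    · exact sub_eq_zero.mp this.1
    · exact sub_eq_zero.mp this.2
  have hbij : Function.Bijective fun x : ZMod p × ZMod p => φ x.1 + φ x.2 * r := by
    rw [Fintype.bijective_iff_injective_and_card]
    refine ⟨hinj2, ?_⟩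
    rw [Fintype.card_prod, ZMod.card, ← Nat.card_eq_fintype_card,
      GaloisField.card p 2 two_ne_zero, sq]
  have hcube : ∀ u v : ZMod p, (φ u + φ v * r) ^ 3 = φ (u ^ 3 + 3 * ε * u * v ^ 2) +
      φ (3 * u ^ 2 * v + ε * v ^ 3) * r := by
    intro u v
    simp only [map_add, map_mul, map_pow, ← hr, map_ofNat]
    ring
  unfold Ocubes
  simp only [Set.mem_ofPred_eq]
  refine and_congr_right fun hab => ?_
  constructor
  · rintro ⟨c, hc, h⟩
    obtain ⟨⟨u, v⟩, rfl⟩ := hbij.2 c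
    simp only [hcube] at h
    have := hinj2 (a₁ := (_, _)) (a₂ := (a, b)) h
    rw [Prod.mk.injEq] at this
    exact ⟨u, v, this.1.symm, this.2.symm⟩
  · rintro ⟨u, v, rfl, rfl⟩
    refine ⟨φ u + φ v * r, ?_, hcube u v⟩
    intro h
    obtain ⟨rfl, rfl⟩ := hind _ _ h
    apply hab
    simp

end Cubes

section CubeSums

/-- First-coordinate-one slice of the cubes. -/
def cubeSlice {p : ℕ} (ε : ZMod p) (t : ZMod p) : Prop :=
  ∃ u v : ZMod p, 1 = u ^ 3 + 3 * ε * u * v ^ 2 ∧ t = 3 * u ^ 2 * v + ε * v ^ 3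

theorem mem_Ocubes_slice {p : ℕ} [Fact p.Prime] (hp3 : p % 3 = 2) {r : GaloisField p 2}
    {ε : ZMod p}
    (hr : r ^ 2 = algebraMap (ZMod p) (GaloisField p 2) ε) (hε : ∀ x : ZMod p, x ^ 2 ≠ ε)
    {k : ZMod p} (hk : k ≠ 0) (t : ZMod p) : (k, k * t) ∈ Ocubes p r ↔ cubeSlice ε t := by
  rw [mem_Ocubes_iff hr hε]
  obtain ⟨c, rfl⟩ := cube_surj hp3 k
  have hc : c ≠ 0 := by
    rintro rfl
    simp at hk
  constructor
  · rintro ⟨-, u, v, h1, h2⟩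
    refine ⟨u / c, v / c, ?_, ?_⟩
    · field_simp
      linear_combination h1
    · field_simp
      linear_combination h2
  · rintro ⟨u, v, h1, h2⟩
    refine ⟨?_, c * u, c * v, ?_, ?_⟩
    · intro h
      exact hk (congrArg Prod.fst h)
    · linear_combination c ^ 3 * h1
    · linear_combination c ^ 3 * h2

open Classical in
theorem three_sum {p : ℕ} [Fact p.Prime] (hp3 : p % 3 = 2) (hp2 : p ≠ 2) {ε σ : ZMod p}
    (hε : ∀ x : ZMod p, x ^ 2 ≠ ε) (hσ : ε * σ ^ 2 = -3) (f : ZMod p → ℂ) :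
    ∑ s ∈ Finset.univ.filter (fun s : ZMod p => 1 + 3 * ε * s ^ 2 ≠ 0),
      f ((3 * s + ε * s ^ 3) / (1 + 3 * ε * s ^ 2)) =
    3 * ∑ t ∈ Finset.univ.filter (fun t : ZMod p => cubeSlice ε t), f t := by
  obtain ⟨h2, h3⟩ := small_ne_zero hp3 hp2
  have hε0 : ε ≠ 0 := fun h => hε 0 (by rw [h]; ring)
  have hσ0 : σ ≠ 0 := by
    rintro rfl
    apply h3
    linear_combination hσ
  have h8 : (8 : ZMod p) ≠ 0 := by
    have : (8 : ZMod p) = 2 ^ 3 := by norm_num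
    rw [this]
    exact pow_ne_zero _ h2
  rw [← Finset.sum_fiberwise_of_maps_to (t := Finset.univ.filter (fun t : ZMod p => cubeSlice ε t))
    (g := fun s : ZMod p => (3 * s + ε * s ^ 3) / (1 + 3 * ε * s ^ 2)), Finset.mul_sum]
  · refine Finset.sum_congr rfl fun t ht => ?_
    have h1 : ∀ s ∈ (Finset.univ.filter (fun s : ZMod p => 1 + 3 * ε * s ^ 2 ≠ 0)).filter
        (fun s => (3 * s + ε * s ^ 3) / (1 + 3 * ε * s ^ 2) = t),
        f ((3 * s + ε * s ^ 3) / (1 + 3 * ε * s ^ 2)) = f t := by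
      intro s hs
      rw [(Finset.mem_filter.mp hs).2]
    rw [Finset.sum_congr rfl h1, Finset.sum_const, nsmul_eq_mul]
    congr 1
    obtain ⟨u, v, hu1, hv⟩ := (Finset.mem_filter.mp ht).2
    have hu0 : u ≠ 0 := by
      rintro rfl
      simp at hu1
    obtain ⟨s, rfl⟩ : ∃ s, v = s * u := ⟨v / u, by field_simp⟩
    have hD1 : u ^ 3 * (1 + 3 * ε * s ^ 2) = 1 := by linear_combination -hu1
    have hD : 1 + 3 * ε * s ^ 2 ≠ 0 := by
      intro h
      rw [h] at hD1
      simp at hD1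
    have ht' : (3 * s + ε * s ^ 3) = t * (1 + 3 * ε * s ^ 2) := by
      rw [hv]
      linear_combination -(3 * s + ε * s ^ 3) * hD1
    have hfac : (1 + 3 * ε * s ^ 2) = (1 - ε * σ * s) * (1 + ε * σ * s) := by
      linear_combination (ε * s ^ 2) * hσ
    have hm : 1 - ε * σ * s ≠ 0 := fun h => hD (by rw [hfac, h, zero_mul])
    have hpl : 1 + ε * σ * s ≠ 0 := fun h => hD (by rw [hfac, h, mul_zero])
    have hes : 1 - ε * s ^ 2 ≠ 0 := by
      intro h
      have hs0 : s ≠ 0 := by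
        rintro rfl
        simp at h
      apply hε (1 / s)
      field_simp
      linear_combination h
    set s2 := (s + σ) / (1 + ε * σ * s) with hs2
    set s3 := (s - σ) / (1 - ε * σ * s) with hs3
    have e2 : s2 * (1 + ε * σ * s) = s + σ := by rw [hs2, div_mul_cancel₀ _ hpl]
    have e3 : s3 * (1 - ε * σ * s) = s - σ := by rw [hs3, div_mul_cancel₀ _ hm]
    have hset : (Finset.univ.filter (fun s : ZMod p => 1 + 3 * ε * s ^ 2 ≠ 0)).filter
        (fun s => (3 * s + ε * s ^ 3) / (1 + 3 * ε * s ^ 2) = t) = {s, s2, s3} := by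
      have key : ∀ x : ZMod p, (3 * x + ε * x ^ 3) * (1 + 3 * ε * s ^ 2)
          - (3 * s + ε * s ^ 3) * (1 + 3 * ε * x ^ 2) = 
          ε * (x - s) * (x * (1 + ε * σ * s) - (s + σ)) * (x * (1 - ε * σ * s) - (s - σ)) := by
        intro x
        linear_combination (x - s) * (ε * x * s - 1) ^ 2 * hσ
      ext x
      simp only [Finset.mem_filter, Finset.mem_univ, true_and, Finset.mem_insert,
        Finset.mem_singleton]
      constructor
      · rintro ⟨hx, hxt⟩
        rw [div_eq_iff hx] at hxt
        have h0 : ε * (x - s) * (x * (1 + ε * σ * s) - (s + σ)) * 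
            (x * (1 - ε * σ * s) - (s - σ)) = 0 := by
          rw [← key x, hxt, ht']
          ring
        rcases mul_eq_zero.mp h0 with h0 | h0
        · rcases mul_eq_zero.mp h0 with h0 | h0
          · rcases mul_eq_zero.mp h0 with h0 | h0
            · exact absurd h0 hε0
            · left
              exact sub_eq_zero.mp h0
          · right; left
            rw [hs2, eq_div_iff hpl]
            exact sub_eq_zero.mp h0
        · right; right
          rw [hs3, eq_div_iff hm]
          exact sub_eq_zero.mp h0
      · intro hx
        have hx0 : 1 + 3 * ε * x ^ 2 ≠ 0 := by
          rcases hx with rfl | rfl | rfl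
          · exact hD
          · intro h
            apply mul_ne_zero h8 hm
            have : (1 + 3 * ε * s2 ^ 2) * (1 + ε * σ * s) ^ 2 = - (8 * (1 - ε * σ * s)) := by
              have : 3 * ε * s2 ^ 2 * (1 + ε * σ * s) ^ 2 = 3 * ε * (s + σ) ^ 2 := by
                rw [← e2]; ring
              linear_combination this + (3 + ε * s ^ 2) * hσ
            rw [h] at this
            linear_combination this
          · intro h
            apply mul_ne_zero h8 hpl
            have : (1 + 3 * ε * s3 ^ 2) * (1 - ε * σ * s) ^ 2 = - (8 * (1 + ε * σ * s)) := by
              have : 3 * ε * s3 ^ 2 * (1 - ε * σ * s) ^ 2 = 3 * ε * (s - σ) ^ 2 := by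
                rw [← e3]; ring
              linear_combination this + (3 + ε * s ^ 2) * hσ
            rw [h] at this
            linear_combination this
        refine ⟨hx0, ?_⟩
        rw [div_eq_iff hx0]
        apply mul_right_cancel₀ hD
        have h0 : ε * (x - s) * (x * (1 + ε * σ * s) - (s + σ)) * 
            (x * (1 - ε * σ * s) - (s - σ)) = 0 := by
          rcases hx with rfl | rfl | rfl
          · ring
          · rw [e2]; ring
          · rw [e3]; ring
        rw [← key x] at h0
        linear_combination h0 + (1 + 3 * ε * x ^ 2) * ht'
    rw [hset, Finset.card_insert_of_notMem, Finset.card_insert_of_notMem, Finset.card_singleton]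
    · norm_num
    · rw [Finset.mem_singleton]
      intro h
      rw [hs2, hs3, div_eq_div_iff hpl hm] at h
      apply mul_ne_zero (mul_ne_zero h2 hσ0) hes
      linear_combination h
    · rw [Finset.mem_insert, Finset.mem_singleton, not_or]
      constructor
      · intro h
        rw [hs2, eq_div_iff hpl] at h
        apply mul_ne_zero hσ0 hes
        linear_combination -h
      · intro h
        rw [hs3, eq_div_iff hm] at h
        apply mul_ne_zero hσ0 hes
        linear_combination h
  · intro s hs
    have hD := (Finset.mem_filter.mp hs).2
    refine Finset.mem_filter.mpr ⟨Finset.mem_univ _, ?_⟩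
    obtain ⟨c, hc⟩ := cube_surj hp3 (1 + 3 * ε * s ^ 2)
    have hc0 : c ≠ 0 := by
      rintro rfl
      apply hD
      rw [← hc]
      ring
    refine ⟨1 / c, s / c, ?_, ?_⟩
    · field_simp
      linear_combination hc
    · rw [← hc]
      field_simp

end CubeSums

section SBounds

open Classical in
/-- The exponential sum over a vertical slice of the set of cubes. -/
noncomputable def Ssum (p : ℕ) [Fact p.Prime] (r : GaloisField p 2) (k m : ZMod p) : ℂ :=
  ∑ b ∈ Finset.univ.filter (fun b : ZMod p => (k, b) ∈ Ocubes p r), ZMod.stdAddChar (m * b)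

open Classical in
theorem Ssum_slice {p : ℕ} [Fact p.Prime] (hp3 : p % 3 = 2) {r : GaloisField p 2} {ε : ZMod p}
    (hr : r ^ 2 = algebraMap (ZMod p) (GaloisField p 2) ε) (hε : ∀ x : ZMod p, x ^ 2 ≠ ε)
    {k : ZMod p} (hk : k ≠ 0) (m : ZMod p) :
    Ssum p r k m = ∑ t ∈ Finset.univ.filter (fun t : ZMod p => cubeSlice ε t),
      (ZMod.stdAddChar (m * (k * t)) : ℂ) := by
  unfold Ssum
  symm
  refine Finset.sum_bij' (fun t _ => k * t) (fun b _ => b / k) ?_ ?_ ?_ ?_ ?_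
  · intro t ht
    simp only [Finset.mem_filter, Finset.mem_univ, true_and] at ht ⊢
    exact (mem_Ocubes_slice hp3 hr hε hk t).mpr ht
  · intro b hb
    simp only [Finset.mem_filter, Finset.mem_univ, true_and] at hb ⊢
    rw [← mem_Ocubes_slice hp3 hr hε hk, mul_div_cancel₀ _ hk]
    exact hb
  · intro t _
    field_simp
  · intro b _
    field_simp
  · intro t _
    rfl

theorem norm_stdAddChar {p : ℕ} [Fact p.Prime] (x : ZMod p) :
    ‖(ZMod.stdAddChar x : ℂ)‖ = 1 := AddChar.norm_apply _ _

theorem D_ne_zero_iff {p : ℕ} [Fact p.Prime] {ε σ : ZMod p} (hε0 : ε ≠ 0) (hσ0 : σ ≠ 0)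
    (hσ : ε * σ ^ 2 = -3) (s : ZMod p) :
    1 + 3 * ε * s ^ 2 ≠ 0 ↔ s ≠ 1 / (ε * σ) ∧ s ≠ -(1 / (ε * σ)) := by
  have hfac : (1 + 3 * ε * s ^ 2) = (1 - ε * σ * s) * (1 + ε * σ * s) := by
    linear_combination (ε * s ^ 2) * hσ
  rw [hfac, mul_ne_zero_iff]
  have hes : ε * σ ≠ 0 := mul_ne_zero hε0 hσ0
  refine and_congr (not_congr ?_) (not_congr ?_)
  · rw [eq_div_iff hes]
    constructor <;> intro h
    · linear_combination -h
    · linear_combination -h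
  · rw [← neg_div, eq_div_iff hes]
    constructor <;> intro h
    · linear_combination h
    · linear_combination h

theorem norm_Ssum_le {p : ℕ} [Fact p.Prime] (hp3 : p % 3 = 2) (hp2 : p ≠ 2)
    {r : GaloisField p 2} {ε : ZMod p}
    (hr : r ^ 2 = algebraMap (ZMod p) (GaloisField p 2) ε) (hε : ∀ x : ZMod p, x ^ 2 ≠ ε)
    {k m : ZMod p} (hk : k ≠ 0) (hm : m ≠ 0) : ‖Ssum p r k m‖ ≤ 4 * Real.sqrt p / 3 := by
  obtain ⟨h2, h3⟩ := small_ne_zero hp3 hp2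
  obtain ⟨σ, hσ⟩ := exists_sigma hp3 hp2 hε
  have hε0 : ε ≠ 0 := fun h => hε 0 (by rw [h]; ring)
  have hσ0 : σ ≠ 0 := by
    rintro rfl
    apply h3
    linear_combination hσ
  have hmk : m * k ≠ 0 := mul_ne_zero hm hk
  have h4 : (4 : ZMod p) ≠ 0 := by
    have : (4 : ZMod p) = 2 ^ 2 := by norm_num
    rw [this]
    exact pow_ne_zero _ h2
  have h9 : (9 : ZMod p) ≠ 0 := by
    have : (9 : ZMod p) = 3 ^ 2 := by norm_num
    rw [this]
    exact pow_ne_zero _ h3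
  have hes : ε * σ ≠ 0 := mul_ne_zero hε0 hσ0
  have hs0 : 1 / (ε * σ) ≠ 0 := one_div_ne_zero hes
  have hs : 1 / (ε * σ) ≠ -(1 / (ε * σ)) := by
    intro h
    apply mul_ne_zero h2 hs0
    linear_combination h
  have hw := weil_sum_bound (ZMod.stdAddChar (N := p)) (ZMod.isPrimitive_stdAddChar p)
    (m * k / 3) (4 * (m * k) / (9 * ε)) (4 * (m * k) / (9 * ε)) _ _ (div_ne_zero hmk h3)
    (div_ne_zero (mul_ne_zero h4 hmk) (mul_ne_zero h9 hε0)) hs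
  have h := three_sum hp3 hp2 hε hσ fun t => (ZMod.stdAddChar (m * (k * t)) : ℂ)
  rw [← Ssum_slice hp3 hr hε hk] at h
  have e : ∑ s ∈ Finset.univ.filter (fun s : ZMod p => 1 + 3 * ε * s ^ 2 ≠ 0),
      (ZMod.stdAddChar (m * (k * ((3 * s + ε * s ^ 3) / (1 + 3 * ε * s ^ 2)))) : ℂ) =
      ∑ x ∈ Finset.univ.filter (fun x : ZMod p => x ≠ 1 / (ε * σ) ∧ x ≠ -(1 / (ε * σ))),
      ZMod.stdAddChar (m * k / 3 * x + 4 * (m * k) / (9 * ε) / (x - 1 / (ε * σ)) +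
        4 * (m * k) / (9 * ε) / (x - -(1 / (ε * σ)))) := by
    refine Finset.sum_congr ?_ ?_
    · ext s
      simp only [Finset.mem_filter, Finset.mem_univ, true_and]
      exact D_ne_zero_iff hε0 hσ0 hσ s
    · intro s hs
      simp only [Finset.mem_filter, Finset.mem_univ, true_and] at hs
      have hD := (D_ne_zero_iff hε0 hσ0 hσ s).mpr hs
      have ha : s - 1 / (ε * σ) ≠ 0 := sub_ne_zero.mpr hs.1
      have hb : s - -(1 / (ε * σ)) ≠ 0 := sub_ne_zero.mpr hs.2
      congr 1
      have hs02 : 3 * ε * (1 / (ε * σ)) ^ 2 = -1 := by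
        field_simp
        linear_combination hσ
      generalize 1 / (ε * σ) = s0 at *
      have hprod : (s - s0) * (s - -s0) * (3 * ε) = 1 + 3 * ε * s ^ 2 := by
        linear_combination -hs02
      rw [← hprod]
      rw [show (9 : ZMod p) = 3 * 3 by norm_num]
      have hb' : s + s0 ≠ 0 := by rwa [sub_neg_eq_add] at hb
      rw [sub_neg_eq_add]
      field_simp
      linear_combination s * hs02
  have e' : (∑ s ∈ Finset.univ.filter (fun s : ZMod p => 1 + 3 * ε * s ^ 2 ≠ 0),
      (ZMod.stdAddChar (m * (k * ((3 * s + ε * s ^ 3) / (1 + 3 * ε * s ^ 2)))) : ℂ)) =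
      3 * Ssum p r k m := by
    rw [← h]
  rw [← e, e', norm_mul] at hw
  rw [le_div_iff₀ (by norm_num)]
  have : ‖(3 : ℂ)‖ = 3 := by simp
  rw [this] at hw
  linarith

theorem norm_Ssum_zero_left {p : ℕ} [Fact p.Prime] (hp3 : p % 3 = 2)
    {r : GaloisField p 2} {ε : ZMod p}
    (hr : r ^ 2 = algebraMap (ZMod p) (GaloisField p 2) ε) (hε : ∀ x : ZMod p, x ^ 2 ≠ ε)
    {m : ZMod p} (hm : m ≠ 0) : ‖Ssum p r 0 m‖ ≤ 1 := by
  classical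
  have hε0 : ε ≠ 0 := fun h => hε 0 (by rw [h]; ring)
  have hset : Finset.univ.filter (fun b : ZMod p => ((0 : ZMod p), b) ∈ Ocubes p r) =
      Finset.univ.erase 0 := by
    ext b
    simp only [Finset.mem_filter, Finset.mem_univ, true_and, Finset.mem_erase, and_true]
    rw [mem_Ocubes_iff hr hε]
    constructor
    · rintro ⟨h, -⟩ rfl
      exact h rfl
    · intro hb
      refine ⟨fun h => hb (congrArg Prod.snd h), ?_⟩
      obtain ⟨v, hv⟩ := cube_surj hp3 (b / ε)
      refine ⟨0, v, by ring, ?_⟩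
      rw [hv]
      field_simp
      ring
  have h0 : ∑ b : ZMod p, (ZMod.stdAddChar (m * b) : ℂ) = 0 := by
    have := AddChar.sum_mulShift m (ZMod.isPrimitive_stdAddChar p)
    rw [if_neg hm] at this
    rw [← Nat.cast_zero, ← this]
    exact Finset.sum_congr rfl fun b _ => by rw [mul_comm]
  have h1 : Ssum p r 0 m = -1 := by
    unfold Ssum
    rw [Finset.sum_congr (s₂ := Finset.univ.erase 0) (by convert hset) fun _ _ => rfl,
      eq_neg_iff_add_eq_zero, ← h0, ← Finset.sum_erase_add _ _ (Finset.mem_univ (0 : ZMod p))]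
    simp
  rw [h1]
  simp

theorem norm_Ssum_zero_zero {p : ℕ} [Fact p.Prime]
    {r : GaloisField p 2} : ‖Ssum p r 0 0‖ ≤ p - 1 := by
  classical
  unfold Ssum
  refine (norm_sum_le _ _).trans ?_
  simp only [zero_mul, AddChar.map_zero_eq_one, norm_one, Finset.sum_const, nsmul_eq_mul, mul_one]
  have hsub : Finset.univ.filter (fun b : ZMod p => ((0 : ZMod p), b) ∈ Ocubes p r) ⊆
      Finset.univ.erase 0 := by
    intro b hb
    simp only [Finset.mem_filter, Finset.mem_univ, true_and, Finset.mem_erase, and_true] at hb ⊢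
    rintro rfl
    exact hb.1 rfl
  have h := Finset.card_le_card hsub
  rw [Finset.card_erase_of_mem (Finset.mem_univ _), Finset.card_univ, ZMod.card] at h
  have hp : 1 ≤ p := (Fact.out : p.Prime).one_lt.le
  have h' : (((Finset.univ.filter (fun b : ZMod p => ((0 : ZMod p), b) ∈ Ocubes p r)).card : ℕ) : ℝ)
      ≤ ((p - 1 : ℕ) : ℝ) := by exact_mod_cast h
  rw [Nat.cast_sub hp, Nat.cast_one] at h'
  convert h'

theorem norm_Ssum_zero_right {p : ℕ} [Fact p.Prime] (hp3 : p % 3 = 2) (hp2 : p ≠ 2)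
    {r : GaloisField p 2} {ε : ZMod p}
    (hr : r ^ 2 = algebraMap (ZMod p) (GaloisField p 2) ε) (hε : ∀ x : ZMod p, x ^ 2 ≠ ε)
    {k : ZMod p} (hk : k ≠ 0) : ‖Ssum p r k 0‖ ≤ (p - 2) / 3 := by
  obtain ⟨h2, h3⟩ := small_ne_zero hp3 hp2
  obtain ⟨σ, hσ⟩ := exists_sigma hp3 hp2 hε
  have hε0 : ε ≠ 0 := fun h => hε 0 (by rw [h]; ring)
  have hσ0 : σ ≠ 0 := by
    rintro rfl
    apply h3
    linear_combination hσ
  have hes : ε * σ ≠ 0 := mul_ne_zero hε0 hσ0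
  have hs0 : 1 / (ε * σ) ≠ 0 := one_div_ne_zero hes
  have hs : 1 / (ε * σ) ≠ -(1 / (ε * σ)) := by
    intro h
    apply mul_ne_zero h2 hs0
    linear_combination h
  have h := three_sum hp3 hp2 hε hσ fun t => (ZMod.stdAddChar ((0 : ZMod p) * (k * t)) : ℂ)
  rw [← Ssum_slice hp3 hr hε hk] at h
  simp only [zero_mul, AddChar.map_zero_eq_one, Finset.sum_const, nsmul_eq_mul, mul_one] at h
  have hn := congrArg norm h
  rw [norm_mul, Complex.norm_natCast] at hn
  have : ‖(3 : ℂ)‖ = 3 := by simp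
  rw [this] at hn
  rw [le_div_iff₀ (by norm_num), mul_comm, ← hn]
  have hsub : Finset.univ.filter (fun s : ZMod p => 1 + 3 * ε * s ^ 2 ≠ 0) ⊆
      (Finset.univ.erase (1 / (ε * σ))).erase (-(1 / (ε * σ))) := by
    intro s hs
    simp only [Finset.mem_filter, Finset.mem_univ, true_and, Finset.mem_erase, and_true] at hs ⊢
    exact ((D_ne_zero_iff hε0 hσ0 hσ s).mp hs).symm
  have h' := Finset.card_le_card hsub
  rw [Finset.card_erase_of_mem (Finset.mem_erase.mpr ⟨hs.symm, Finset.mem_univ _⟩),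
    Finset.card_erase_of_mem (Finset.mem_univ _), Finset.card_univ, ZMod.card] at h'
  have hp : 2 ≤ p := (Fact.out : p.Prime).two_le
  have h'' : (((Finset.univ.filter (fun s : ZMod p => 1 + 3 * ε * s ^ 2 ≠ 0)).card : ℕ) : ℝ)
      ≤ ((p - 2 : ℕ) : ℝ) := by exact_mod_cast h'
  rw [Nat.cast_sub hp, Nat.cast_ofNat] at h''
  convert h''

/-- Symmetry of the set of cubes. -/
theorem neg_mem_Ocubes {p : ℕ} [Fact p.Prime] {r : GaloisField p 2} {a b : ZMod p}
    (h : (a, b) ∈ Ocubes p r) : (-a, -b) ∈ Ocubes p r := by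
  obtain ⟨h0, c, hc, h1⟩ := h
  refine ⟨?_, -c, neg_ne_zero.mpr hc, ?_⟩
  · intro h
    apply h0
    rw [Prod.mk_eq_zero] at h ⊢
    exact ⟨neg_eq_zero.mp h.1, neg_eq_zero.mp h.2⟩
  · simp only [map_neg] at h1 ⊢
    linear_combination -h1

theorem nsEps_two : nsEps 2 = 0 := by
  have : leastNonResidue 2 = 0 := by
    unfold leastNonResidue
    have h : {n : ℕ | 0 < n ∧ ¬∃ x : ZMod 2, x ^ 2 = (n : ZMod 2)} = ∅ := by
      ext n
      simp only [Set.mem_ofPred_eq, Set.mem_empty_iff_false, iff_false, not_and, not_not]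
      intro _
      refine ⟨(n : ZMod 2), ?_⟩
      generalize (n : ZMod 2) = x
      revert x
      decide
    rw [h, Nat.sInf_empty]
  unfold nsEps
  rw [this, Nat.cast_zero]

theorem zmod_two_cases : ∀ k : ZMod 2, k = 0 ∨ k = 1 := by decide

theorem norm_Ssum_two [Fact (Nat.Prime 2)] {r : GaloisField 2 2}
    (hr : r ^ 2 = algebraMap (ZMod 2) (GaloisField 2 2) (nsEps 2)) (k m : ZMod 2) :
    ‖Ssum 2 r k m‖ ≤ if k ≠ 0 ∧ m = 0 then 2 else 0 := by
  classical
  have hr0 : r = 0 := by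
    rw [nsEps_two, map_zero] at hr
    exact pow_eq_zero_iff two_ne_zero |>.mp hr
  have h0 : ∀ b : ZMod 2, ((0 : ZMod 2), b) ∉ Ocubes 2 r := by
    rintro b ⟨-, c, hc, h⟩
    rw [hr0] at h
    simp only [map_zero, mul_zero, add_zero] at h
    exact hc (pow_eq_zero_iff three_ne_zero |>.mp h)
  have h1 : ∀ b : ZMod 2, ((1 : ZMod 2), b) ∈ Ocubes 2 r := by
    intro b
    refine ⟨fun h => one_ne_zero (congrArg Prod.fst h), 1, one_ne_zero, ?_⟩
    rw [hr0]
    simp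
  have hk : k = 0 ∨ k = 1 := zmod_two_cases k
  have hm : m = 0 ∨ m = 1 := zmod_two_cases m
  rcases hk with rfl | rfl
  · unfold Ssum
    simp [h0]
  · rcases hm with rfl | rfl
    · unfold Ssum
      rw [if_pos ⟨one_ne_zero, rfl⟩]
      refine (norm_sum_le _ _).trans ?_
      simp [h1]
    · unfold Ssum
      rw [if_neg (fun h => one_ne_zero h.2)]
      have h2 : ∑ b : ZMod 2, (ZMod.stdAddChar (1 * b) : ℂ) = 0 := by
        have := AddChar.sum_mulShift (1 : ZMod 2) (ZMod.isPrimitive_stdAddChar 2)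
        rw [if_neg one_ne_zero] at this
        rw [← Nat.cast_zero, ← this]
        exact Finset.sum_congr rfl fun b _ => by rw [mul_comm]
      rw [Finset.filter_true_of_mem (fun b _ => h1 b), h2, norm_zero]

end SBounds

section Analysis

theorem log_expansion (w ζ : ℂ) (p j : ℕ) (hw : ‖w‖ < 1) (hζ : ‖ζ‖ ≤ 1) (hp : 0 < p)
    (hj : 0 < j) : ∃ F : ℂ, HasProd (fun n : ℕ => 1 - w ^ (n * p + j) * ζ) (Complex.exp F) ∧
      HasSum (fun m : ℕ => w ^ (j * m) * ζ ^ m / ((1 - w ^ (p * m)) * m)) (-F) := by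
  set z : ℕ → ℂ := fun n => w ^ (n * p + j) * ζ with hz
  have hw0 : 0 ≤ ‖w‖ := norm_nonneg w
  have hzn : ∀ n, ‖z n‖ ≤ ‖w‖ ^ (n + 1) := by
    intro n
    rw [hz]
    simp only [norm_mul, norm_pow]
    calc ‖w‖ ^ (n * p + j) * ‖ζ‖ ≤ ‖w‖ ^ (n * p + j) * 1 := by gcongr
      _ = ‖w‖ ^ (n * p + j) := mul_one _
      _ ≤ ‖w‖ ^ (n + 1) := by
        apply pow_le_pow_of_le_one hw0 hw.le
        nlinarith
  have hz1 : ∀ n, ‖z n‖ < 1 := fun n =>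
    (hzn n).trans_lt (pow_lt_one₀ hw0 hw (Nat.succ_ne_zero n))
  set f : ℕ × ℕ → ℂ := fun x => (z x.1) ^ x.2 / x.2 with hf
  have hsum : Summable f := by
    have hg := summable_geometric_of_lt_one hw0 hw
    have hg2 : Summable fun x : ℕ × ℕ => ‖w‖ ^ x.1 * ‖w‖ ^ x.2 :=
      hg.mul_of_nonneg hg (fun n => pow_nonneg hw0 n) (fun n => pow_nonneg hw0 n)
    refine Summable.of_norm_bounded hg2 ?_
    rintro ⟨n, m⟩
    simp only [hf, norm_div, norm_pow, Complex.norm_natCast]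
    rcases Nat.eq_zero_or_pos m with rfl | hm
    · simp only [Nat.cast_zero, div_zero]
      positivity
    · calc ‖z n‖ ^ m / m ≤ ‖z n‖ ^ m := by
            apply div_le_self (by positivity)
            exact_mod_cast hm
        _ ≤ (‖w‖ ^ (n + 1)) ^ m := by
            gcongr
            exact hzn n
        _ = ‖w‖ ^ ((n + 1) * m) := by rw [pow_mul]
        _ ≤ ‖w‖ ^ (n + m) := by
            apply pow_le_pow_of_le_one hw0 hw.le
            nlinarith
        _ = ‖w‖ ^ n * ‖w‖ ^ m := pow_add _ _ _
  obtain ⟨T, hT⟩ := hsum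
  have h1 : HasSum (fun n => -Complex.log (1 - z n)) T := by
    have hh : ∀ n : ℕ, HasSum (fun c : ℕ => f (n, c)) (-Complex.log (1 - z n)) := by
      intro n
      simp only [hf]
      have := Complex.hasSum_taylorSeries_neg_log (hz1 n)
      exact this
    exact hT.prod_fiberwise hh
  have hT' : HasSum (f ∘ Prod.swap) T := (Equiv.prodComm ℕ ℕ).hasSum_iff.mpr hT
  have h2 : HasSum (fun m : ℕ => w ^ (j * m) * ζ ^ m / ((1 - w ^ (p * m)) * m)) T := by
    suffices h : ∀ m : ℕ, HasSum (fun n : ℕ => (f ∘ Prod.swap) (m, n))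
        (w ^ (j * m) * ζ ^ m / ((1 - w ^ (p * m)) * m)) from hT'.prod_fiberwise h
    intro m
    simp only [Function.comp, Prod.swap, hf, hz]
    rcases Nat.eq_zero_or_pos m with rfl | hm
    · simp
    · have hlt : ‖w ^ (p * m)‖ < 1 := by
        rw [norm_pow]
        exact pow_lt_one₀ hw0 hw (by positivity)
      have := (hasSum_geometric_of_norm_lt_one hlt).mul_left (w ^ (j * m) * ζ ^ m / m)
      have e1 : (fun n : ℕ => (w ^ (n * p + j) * ζ) ^ m / (m : ℂ)) =
          fun n => w ^ (j * m) * ζ ^ m / m * (w ^ (p * m)) ^ n := by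
        funext n
        rw [mul_pow, ← pow_mul, ← pow_mul, add_mul, pow_add]
        rw [show n * p * m = p * m * n by ring]
        ring
      have e2 : w ^ (j * m) * ζ ^ m / ((1 - w ^ (p * m)) * m) =
          w ^ (j * m) * ζ ^ m / m * (1 - w ^ (p * m))⁻¹ := by
        rw [← div_eq_mul_inv, div_div, mul_comm (m : ℂ)]
      rw [e2]
      exact e1 ▸ this
  have h2' : HasSum (fun m : ℕ => w ^ (j * m) * ζ ^ m / ((1 - w ^ (p * m)) * m)) (- -T) := by
    simpa only [neg_neg] using h2
  refine ⟨-T, ?_, h2'⟩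
  have h3 := h1.neg.cexp
  have e : (fun n : ℕ => 1 - w ^ (n * p + j) * ζ) =
      Complex.exp ∘ fun n => - -Complex.log (1 - z n) := by
    funext n
    simp only [Function.comp, neg_neg]
    rw [Complex.exp_log]
    intro h
    have := hz1 n
    rw [← sub_eq_zero.mp h] at this
    simp at this
  rw [e]
  exact h3

/-- The Lambert kernel. -/
noncomputable def gker (z : ℝ) : ℝ := 1 / (Real.exp z - 1)

theorem gker_pos {z : ℝ} (hz : 0 < z) : 0 < gker z :=
  one_div_pos.mpr (by linarith [Real.add_one_lt_exp hz.ne'])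

theorem gker_le {z : ℝ} (hz : 0 < z) : gker z ≤ 1 / z :=
  one_div_le_one_div_of_le hz (by linarith [Real.add_one_le_exp z])

theorem gker_mul_le {z : ℝ} (hz : 0 < z) {p : ℕ} (hp : 0 < p) : gker (p * z) ≤ gker z / p := by
  unfold gker
  rw [div_div]
  have h1 : 0 < Real.exp z - 1 := by linarith [Real.add_one_lt_exp hz.ne']
  have hp' : (0 : ℝ) < p := by exact_mod_cast hp
  apply one_div_le_one_div_of_le (by positivity)
  have h2 := one_add_mul_le_pow (a := Real.exp z - 1) (by linarith) p
  rw [Real.exp_nat_mul]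
  rw [add_sub_cancel] at h2
  linarith

theorem lambert_sum {p : ℕ} (hp : 1 < p) {y B κ : ℝ} (hy : 0 < y) (hB : 0 ≤ B) (hκ : 0 ≤ κ)
    (hκB : κ ≤ B * p) (A : ℕ → ℝ)
    (h1 : ∀ m, 0 < m → ¬ p ∣ m → A m ≤ B * gker (m * y) - κ * gker (p * (m * y)))
    (h2 : ∀ m, 0 < m → p ∣ m → A m ≤ κ * p * gker (m * y)) (N : ℕ) :
    ∑ m ∈ Finset.Icc 1 N, A m / m ≤ B * (Real.pi ^ 2 / 6) / y := by
  have hp0 : 0 < p := by omega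
  have hp' : (0 : ℝ) < p := by exact_mod_cast hp0
  set d : ℕ → ℝ := fun m => gker (p * (m * y)) / m with hd
  have hd0 : ∀ m ∈ Finset.Icc 1 N, 0 ≤ d m := by
    intro m hm
    have hm0 : (0 : ℝ) < m := by exact_mod_cast (Finset.mem_Icc.mp hm).1
    have := gker_pos (z := p * (m * y)) (by positivity)
    simp only [hd]
    positivity
  have key : ∀ m ∈ Finset.Icc 1 N, A m / m ≤ B * gker (m * y) / m - κ * d m +
      (if p ∣ m then κ * d (m / p) else 0) := by
    intro m hm
    have hm1 : 0 < m := (Finset.mem_Icc.mp hm).1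
    have hm0 : (0 : ℝ) < m := by exact_mod_cast hm1
    have hmy : 0 < m * y := by positivity
    split_ifs with hpm
    · obtain ⟨n, rfl⟩ := hpm
      have hn0 : (0 : ℝ) < n := by
        have : 0 < n := Nat.pos_of_mul_pos_left hm1
        exact_mod_cast this
      rw [Nat.mul_div_cancel_left n hp0]
      have e1 := h2 _ hm1 (Dvd.intro n rfl)
      have e2 : A (p * n) / ((p * n : ℕ) : ℝ) ≤ κ * d n := by
        rw [div_le_iff₀ hm0]
        refine e1.trans (le_of_eq ?_)
        simp only [hd]
        push_cast
        field_simp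
      have e3 : κ * d (p * n) ≤ B * gker ((p * n : ℕ) * y) / ((p * n : ℕ) : ℝ) := by
        simp only [hd]
        rw [← mul_div_assoc]
        apply div_le_div_of_nonneg_right _ hm0.le
        calc κ * gker (p * ((p * n : ℕ) * y)) ≤ κ * (gker ((p * n : ℕ) * y) / p) := by
              gcongr
              exact gker_mul_le hmy hp0
          _ ≤ (B * p) * (gker ((p * n : ℕ) * y) / p) := by
              have := (gker_pos hmy).le
              gcongr
          _ = B * gker ((p * n : ℕ) * y) := by field_simp
      linarith
    · rw [add_zero]
      have e1 := h1 m hm1 hpm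
      simp only [hd]
      rw [← mul_div_assoc, ← sub_div]
      gcongr
  have hsumd : ∑ m ∈ Finset.Icc 1 N, (if p ∣ m then κ * d (m / p) else 0) ≤
      ∑ m ∈ Finset.Icc 1 N, κ * d m := by
    rw [← Finset.sum_filter]
    have hinj : Set.InjOn (fun m => m / p) (((Finset.Icc 1 N).filter (fun m => p ∣ m) :
        Finset ℕ) : Set ℕ) := by
      intro a ha b hb hab
      have ha' := (Finset.mem_filter.mp (Finset.mem_coe.mp ha)).2
      have hb' := (Finset.mem_filter.mp (Finset.mem_coe.mp hb)).2
      simp only at hab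
      rw [← Nat.div_mul_cancel ha', hab, Nat.div_mul_cancel hb']
    rw [← Finset.sum_image (f := fun m => κ * d m) hinj]
    apply Finset.sum_le_sum_of_subset_of_nonneg
    · intro x hx
      obtain ⟨m, hm, rfl⟩ := Finset.mem_image.mp hx
      obtain ⟨hm1, hm2⟩ := Finset.mem_filter.mp hm
      obtain ⟨n, rfl⟩ := hm2
      rw [Nat.mul_div_cancel_left n hp0]
      rw [Finset.mem_Icc] at hm1 ⊢
      constructor
      · exact Nat.pos_of_mul_pos_left hm1.1
      · nlinarith [hm1.2]
    · intro m hm _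
      exact mul_nonneg hκ (hd0 m hm)
  have hmain : ∑ m ∈ Finset.Icc 1 N, A m / m ≤ ∑ m ∈ Finset.Icc 1 N, B / y * (1 / (m : ℝ) ^ 2) := by
    calc ∑ m ∈ Finset.Icc 1 N, A m / m ≤ ∑ m ∈ Finset.Icc 1 N, (B * gker (m * y) / m - κ * d m +
          (if p ∣ m then κ * d (m / p) else 0)) := Finset.sum_le_sum key
      _ ≤ ∑ m ∈ Finset.Icc 1 N, B * gker (m * y) / m := by
          rw [Finset.sum_add_distrib, Finset.sum_sub_distrib]
          linarith
      _ ≤ _ := by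
          apply Finset.sum_le_sum
          intro m hm
          have hm0 : (0 : ℝ) < m := by exact_mod_cast (Finset.mem_Icc.mp hm).1
          have hmy : 0 < m * y := by positivity
          calc B * gker (m * y) / m ≤ B * (1 / (m * y)) / m := by
                gcongr
                exact gker_le hmy
            _ = _ := by field_simp
  refine hmain.trans ?_
  rw [← Finset.mul_sum]
  have := sum_le_hasSum (Finset.Icc 1 N) (fun m _ => by positivity) hasSum_zeta_two
  calc B / y * _ ≤ B / y * (Real.pi ^ 2 / 6) := by gcongr
    _ = _ := by ring

end Analysis

section Assembly

/-- The least positive representative of a residue class. -/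
def kap {p : ℕ} (a : ZMod p) : ℕ := if a = 0 then p else a.val

theorem kap_pos {p : ℕ} [Fact p.Prime] (a : ZMod p) : 0 < kap a := by
  unfold kap
  split_ifs with h
  · exact (Fact.out : p.Prime).pos
  · rw [Nat.pos_iff_ne_zero, Ne, ZMod.val_eq_zero]
    exact h

theorem e_val {p : ℕ} [Fact p.Prime] (b : ZMod p) :
    e2πi ((ZMod.val b : ℝ) / p) = ZMod.stdAddChar b := by
  rw [ZMod.stdAddChar_apply, ZMod.toCircle_apply]
  unfold e2πi
  congr 1
  push_cast
  ring

theorem e_neg_val {p : ℕ} [Fact p.Prime] (b : ZMod p) :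
    e2πi (-((ZMod.val b : ℝ) / p)) = ZMod.stdAddChar (-b) := by
  rw [AddChar.map_neg_eq_inv, ← e_val]
  unfold e2πi
  rw [← Complex.exp_neg]
  congr 1
  push_cast
  ring

theorem qpow_nat {p : ℕ} (hp : 0 < p) (τ : ℂ) (n : ℕ) (x : ℝ) (hx : x = n / p) :
    qpow τ x = qpow τ (1 / p) ^ n := by
  have hp' : (p : ℂ) ≠ 0 := by exact_mod_cast hp.ne'
  unfold qpow
  rw [← Complex.exp_nat_mul, hx]
  congr 1
  push_cast
  field_simp

theorem norm_qpow (τ : ℂ) (x : ℝ) : ‖qpow τ x‖ = Real.exp (-(2 * Real.pi * τ.im * x)) := by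
  unfold qpow
  rw [Complex.norm_exp]
  congr 1
  have : 2 * (Real.pi : ℂ) * Complex.I * x * τ = ((2 * Real.pi * x : ℝ) : ℂ) * (Complex.I * τ) := by
    push_cast
    ring
  rw [this, Complex.re_ofReal_mul]
  simp
  ring

theorem Rfac_eq {p : ℕ} [Fact p.Prime] (τ : ℂ) (F : ZMod p → ZMod p → ℂ)
    (hF : ∀ a b : ZMod p, HasProd (fun n : ℕ => 1 - qpow τ (1 / p) ^ (n * p + kap a) *
      (ZMod.stdAddChar b : ℂ)) (Complex.exp (F a b))) (a b : ZMod p) :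
    Rfac p τ (a, b) = Complex.exp (F a b + F (-a) (-b)) := by
  have hp : 0 < p := (Fact.out : p.Prime).pos
  have hp' : (p : ℝ) ≠ 0 := by exact_mod_cast hp.ne'
  rw [Complex.exp_add, ← ((hF a b).mul (hF (-a) (-b))).tprod_eq]
  unfold Rfac
  simp only [e_val, e_neg_val]
  split_ifs with ha
  · subst ha
    congr 1
    funext n
    have h : qpow τ ((n : ℝ) + 1) = qpow τ (1 / p) ^ (n * p + p) := by
      apply qpow_nat hp
      push_cast
      field_simp
    rw [h]
    simp [kap]
  · congr 1
    funext n
    have hna : -a ≠ 0 := neg_ne_zero.mpr ha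
    have h1 : qpow τ ((n : ℝ) + (ZMod.val a : ℝ) / p) = qpow τ (1 / p) ^ (n * p + a.val) := by
      apply qpow_nat hp
      push_cast
      field_simp
    have h2 : qpow τ ((n : ℝ) + 1 - (ZMod.val a : ℝ) / p) =
        qpow τ (1 / p) ^ (n * p + (-a).val) := by
      apply qpow_nat hp
      rw [ZMod.neg_val, if_neg ha]
      push_cast [Nat.cast_sub (ZMod.val_lt a).le]
      field_simp
      ring
    rw [h1, h2]
    simp only [kap, if_neg ha, if_neg hna]

/-- The weights. -/
noncomputable def Gw {p : ℕ} (y : ℝ) (a : ZMod p) (m : ℕ) : ℝ :=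
  Real.exp (-y) ^ (kap a * m) / (1 - Real.exp (-y) ^ (p * m))

/-- The weighted sums of the absolute values of the exponential sums. -/
noncomputable def Aterm (p : ℕ) [Fact p.Prime] (r : GaloisField p 2) (y : ℝ) (m : ℕ) : ℝ :=
  ∑ a : ZMod p, Gw y a m * ‖Ssum p r a m‖

theorem abs_log_bound {p : ℕ} [Fact p.Prime] (r : GaloisField p 2) (τ : ℂ) {y C : ℝ}
    (hy : 0 < y) (hyτ : 2 * Real.pi * τ.im * (1 / p) = y)
    (hC : ∀ N, ∑ m ∈ Finset.Icc 1 N, Aterm p r y m / m ≤ C) :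
    |Real.log ‖Rprod p r τ‖| ≤ 6 * C := by
  classical
  have hp : 0 < p := (Fact.out : p.Prime).pos
  set w := qpow τ (1 / p) with hw
  have hwn : ‖w‖ = Real.exp (-y) := by rw [hw, norm_qpow, hyτ]
  have hw1 : ‖w‖ < 1 := by
    rw [hwn, Real.exp_lt_one_iff]
    linarith
  choose F hF1 hF2 using fun a b : ZMod p => log_expansion w (ZMod.stdAddChar b : ℂ) p (kap a) hw1
    (norm_stdAddChar b).le hp (kap_pos a)
  have hR := Rfac_eq τ F hF1
  set O : Finset (ZMod p × ZMod p) := Finset.univ.filter (fun x => x ∈ Ocubes p r) with hO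
  have hprod : Rprod p r τ = Complex.exp (∑ x ∈ O, 3 * (F x.1 x.2 + F (-x.1) (-x.2))) := by
    unfold Rprod
    rw [finprod_mem_eq_finite_toFinset_prod _ (Set.toFinite _), Complex.exp_sum]
    refine Finset.prod_congr ?_ ?_
    · ext x
      simp [hO]
    · rintro ⟨a, b⟩ _
      rw [hR, ← Complex.exp_nat_mul]
      norm_num
  have hsymm : ∑ x ∈ O, F (-x.1) (-x.2) = ∑ x ∈ O, F x.1 x.2 := by
    refine Finset.sum_bij' (fun x _ => -x) (fun x _ => -x) ?_ ?_ ?_ ?_ ?_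
    · rintro ⟨a, b⟩ h
      simp only [hO, Finset.mem_filter, Finset.mem_univ, true_and] at h ⊢
      exact neg_mem_Ocubes h
    · rintro ⟨a, b⟩ h
      simp only [hO, Finset.mem_filter, Finset.mem_univ, true_and] at h ⊢
      exact neg_mem_Ocubes h
    · intro x _
      exact neg_neg x
    · intro x _
      exact neg_neg x
    · intro x _
      rfl
  have hlog : Real.log ‖Rprod p r τ‖ = 6 * (∑ x ∈ O, F x.1 x.2).re := by
    rw [hprod, Complex.norm_exp, Real.log_exp, ← Finset.mul_sum, Finset.sum_add_distrib, hsymm]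
    have : (3 : ℂ) * (∑ x ∈ O, F x.1 x.2 + ∑ x ∈ O, F x.1 x.2) =
        ((6 : ℝ) : ℂ) * ∑ x ∈ O, F x.1 x.2 := by
      push_cast
      ring
    rw [this, Complex.re_ofReal_mul]
  have hsum : HasSum (fun m : ℕ => ∑ x ∈ O, w ^ (kap x.1 * m) * (ZMod.stdAddChar x.2 : ℂ) ^ m /
      ((1 - w ^ (p * m)) * m)) (∑ x ∈ O, -F x.1 x.2) :=
    hasSum_sum fun x _ => hF2 x.1 x.2
  have hterm : ∀ m : ℕ, 0 < m → ‖∑ x ∈ O, w ^ (kap x.1 * m) * (ZMod.stdAddChar x.2 : ℂ) ^ m /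
      ((1 - w ^ (p * m)) * m)‖ ≤ Aterm p r y m / m := by
    intro m hm
    have e : ∑ x ∈ O, w ^ (kap x.1 * m) * (ZMod.stdAddChar x.2 : ℂ) ^ m /
        ((1 - w ^ (p * m)) * m) =
        (∑ a : ZMod p, w ^ (kap a * m) / (1 - w ^ (p * m)) * Ssum p r a m) / m := by
      rw [hO, Finset.sum_filter, Fintype.sum_prod_type, Finset.sum_div]
      refine Finset.sum_congr rfl fun a _ => ?_
      unfold Ssum
      rw [Finset.sum_filter, Finset.mul_sum, Finset.sum_div]
      refine Finset.sum_congr rfl fun b _ => ?_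
      split_ifs
      · rw [← AddChar.map_nsmul_eq_pow, nsmul_eq_mul, ← div_div]
        ring
      · simp
    rw [e, norm_div, Complex.norm_natCast]
    apply div_le_div_of_nonneg_right _ (Nat.cast_nonneg m)
    unfold Aterm
    refine (norm_sum_le _ _).trans (Finset.sum_le_sum fun a _ => ?_)
    rw [norm_mul, norm_div, norm_pow, hwn]
    apply mul_le_mul_of_nonneg_right _ (norm_nonneg _)
    unfold Gw
    have hlt : Real.exp (-y) ^ (p * m) < 1 := by
      rw [← hwn]
      exact pow_lt_one₀ (norm_nonneg _) hw1 (by positivity)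
    apply div_le_div_of_nonneg_left (by positivity) (by linarith)
    have := norm_sub_norm_le (1 : ℂ) (w ^ (p * m))
    rwa [norm_one, norm_pow, hwn] at this
  have hnorm : ‖∑ x ∈ O, -F x.1 x.2‖ ≤ C := by
    refine le_of_tendsto hsum.tendsto_sum_nat.norm (Filter.Eventually.of_forall fun N => ?_)
    rcases Nat.eq_zero_or_pos N with rfl | hN
    · simpa using hC 0
    · refine le_trans ?_ (hC (N - 1))
      have e : Finset.range N = insert 0 (Finset.Icc 1 (N - 1)) := by
        ext i
        simp only [Finset.mem_range, Finset.mem_insert, Finset.mem_Icc]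
        omega
      rw [e, Finset.sum_insert (by simp)]
      simp only [Nat.cast_zero, mul_zero, div_zero, Finset.sum_const_zero, zero_add]
      refine (norm_sum_le _ _).trans (Finset.sum_le_sum fun m hm => ?_)
      exact hterm m (Finset.mem_Icc.mp hm).1
  rw [Finset.sum_neg_distrib, norm_neg] at hnorm
  rw [hlog, abs_mul, abs_of_pos (by norm_num : (0 : ℝ) < 6)]
  have := (Complex.abs_re_le_norm (∑ x ∈ O, F x.1 x.2)).trans hnorm
  linarith

theorem Gw_zero {p : ℕ} {y : ℝ} (hy : 0 < y) (hp : 0 < p) {m : ℕ} (hm : 0 < m) :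
    Gw y (0 : ZMod p) m = gker (p * (m * y)) := by
  unfold Gw gker
  have e : Real.exp (-y) ^ (p * m) = (Real.exp (p * (m * y)))⁻¹ := by
    rw [← Real.exp_nat_mul, ← Real.exp_neg]
    congr 1
    push_cast
    ring
  have hp' : (0 : ℝ) < p := by exact_mod_cast hp
  have hm' : (0 : ℝ) < m := by exact_mod_cast hm
  have h1 : 1 < Real.exp (p * (m * y)) := by
    rw [Real.one_lt_exp_iff]
    positivity
  simp only [kap, if_true]
  rw [e]
  have h2 : Real.exp (p * (m * y)) - 1 ≠ 0 := by linarith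
  have h3 : Real.exp (p * (m * y)) ≠ 0 := (Real.exp_pos _).ne'
  generalize Real.exp (p * (m * y)) = E at *
  have h4 : 1 - E⁻¹ = (E - 1) / E := by field_simp
  rw [h4]
  field_simp

theorem sum_val_pow {p : ℕ} [Fact p.Prime] (X : ℝ) :
    ∑ a : ZMod p, X ^ a.val = ∑ i ∈ Finset.range p, X ^ i := by
  refine Finset.sum_bij' (fun a _ => a.val) (fun i _ => (i : ZMod p)) ?_ ?_ ?_ ?_ ?_
  · intro a _
    exact Finset.mem_range.mpr (ZMod.val_lt a)
  · intro i _
    exact Finset.mem_univ _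
  · intro a _
    exact ZMod.natCast_zmod_val a
  · intro i hi
    exact ZMod.val_cast_of_lt (Finset.mem_range.mp hi)
  · intro a _
    rfl

theorem Gw_sum {p : ℕ} [Fact p.Prime] {y : ℝ} (hy : 0 < y) {m : ℕ} (hm : 0 < m) :
    ∑ a : ZMod p, Gw y a m = gker (m * y) := by
  have hp : 0 < p := (Fact.out : p.Prime).pos
  have hm' : (0 : ℝ) < m := by exact_mod_cast hm
  unfold Gw
  rw [← Finset.sum_div]
  have hX : Real.exp (-y) ^ m = (Real.exp (m * y))⁻¹ := by
    rw [← Real.exp_nat_mul, ← Real.exp_neg]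
    congr 1
    ring
  simp only [mul_comm _ m, pow_mul]
  have hE : 1 < Real.exp (m * y) := by
    rw [Real.one_lt_exp_iff]
    positivity
  set X := Real.exp (-y) ^ m with hXd
  have hX0 : 0 < X := by positivity
  have hX1 : X < 1 := by
    rw [hX]
    exact inv_lt_one_of_one_lt₀ hE
  have hsum : ∑ a : ZMod p, X ^ kap a = X ^ p - 1 + ∑ i ∈ Finset.range p, X ^ i := by
    rw [← sum_val_pow, ← Finset.add_sum_erase _ _ (Finset.mem_univ (0 : ZMod p)),
      ← Finset.add_sum_erase _ (fun a : ZMod p => X ^ a.val) (Finset.mem_univ (0 : ZMod p))]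
    have : ∑ a ∈ Finset.univ.erase (0 : ZMod p), X ^ kap a =
        ∑ a ∈ Finset.univ.erase (0 : ZMod p), X ^ a.val := by
      refine Finset.sum_congr rfl fun a ha => ?_
      rw [kap, if_neg (Finset.ne_of_mem_erase ha)]
    rw [this]
    simp [kap]
    ring
  rw [hsum, geom_sum_eq hX1.ne]
  have hXp : X ^ p < 1 := pow_lt_one₀ hX0.le hX1 hp.ne'
  have hk : gker (m * y) = X / (1 - X) := by
    unfold gker
    rw [hX]
    have h2 : Real.exp (m * y) - 1 ≠ 0 := by linarith
    have h3 : Real.exp (m * y) ≠ 0 := (Real.exp_pos _).ne'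
    generalize Real.exp (m * y) = E at *
    have h4 : 1 - E⁻¹ = (E - 1) / E := by field_simp
    rw [h4]
    field_simp
  rw [hk]
  have h5 : 1 - X ≠ 0 := by linarith
  have h6 : X - 1 ≠ 0 := by linarith
  have h7 : 1 - X ^ p ≠ 0 := by linarith
  field_simp
  ring

theorem Aterm_le {p : ℕ} [Fact p.Prime] (r : GaloisField p 2) {y β γ : ℝ} (hy : 0 < y) {m : ℕ}
    (hm : 0 < m) (h0 : ‖Ssum p r 0 m‖ ≤ γ) (h1 : ∀ a : ZMod p, a ≠ 0 → ‖Ssum p r a m‖ ≤ β) :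
    Aterm p r y m ≤ β * gker (m * y) - (β - γ) * gker (p * (m * y)) := by
  have hp : 0 < p := (Fact.out : p.Prime).pos
  have hG0 : ∀ a : ZMod p, 0 ≤ Gw y a m := by
    intro a
    unfold Gw
    apply div_nonneg (by positivity)
    have : Real.exp (-y) ^ (p * m) ≤ 1 := pow_le_one₀ (Real.exp_pos _).le
      (Real.exp_le_one_iff.mpr (by linarith))
    linarith
  rw [← Gw_zero hy hp hm, ← Gw_sum (p := p) hy hm]
  unfold Aterm
  rw [← Finset.add_sum_erase _ _ (Finset.mem_univ (0 : ZMod p)),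
    ← Finset.add_sum_erase _ (fun a : ZMod p => Gw y a m) (Finset.mem_univ (0 : ZMod p))]
  have e1 : ∑ a ∈ Finset.univ.erase (0 : ZMod p), Gw y a m * ‖Ssum p r a m‖ ≤
      β * ∑ a ∈ Finset.univ.erase (0 : ZMod p), Gw y a m := by
    rw [Finset.mul_sum]
    refine Finset.sum_le_sum fun a ha => ?_
    rw [mul_comm β]
    exact mul_le_mul_of_nonneg_left (h1 a (Finset.ne_of_mem_erase ha)) (hG0 a)
  have e2 := mul_le_mul_of_nonneg_left h0 (hG0 0)
  nlinarith

theorem Aterm_sum_odd {p : ℕ} [Fact p.Prime] (hp3 : p % 3 = 2) (hp2 : p ≠ 2)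
    (r : GaloisField p 2) (hr : r ^ 2 = algebraMap (ZMod p) (GaloisField p 2) (nsEps p))
    {y : ℝ} (hy : 0 < y) (N : ℕ) : ∑ m ∈ Finset.Icc 1 N, Aterm p r y m / m ≤
      (4 * Real.sqrt p / 3) * (Real.pi ^ 2 / 6) / y := by
  have hp : p.Prime := Fact.out
  have hε := nsEps_spec hp2
  have hp1 : (1 : ℝ) ≤ p := by exact_mod_cast hp.one_lt.le
  have hsq : 1 ≤ Real.sqrt p := Real.one_le_sqrt.mpr hp1
  refine lambert_sum (κ := 1 / 3) hp.one_lt hy (by positivity) (by norm_num) (by nlinarith) _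
    ?_ ?_ N
  · intro m hm hpm
    have hm0 : (m : ZMod p) ≠ 0 := by rwa [Ne, ZMod.natCast_eq_zero_iff]
    have h := Aterm_le r hy hm (norm_Ssum_zero_left hp3 hr hε hm0)
      (fun a ha => norm_Ssum_le hp3 hp2 hr hε ha hm0)
    have hm' : (0 : ℝ) < m := by exact_mod_cast hm
    have hg := gker_pos (z := p * (m * y)) (by positivity)
    nlinarith
  · intro m hm hpm
    have hm0 : (m : ZMod p) = 0 := by rwa [ZMod.natCast_eq_zero_iff]
    have h := Aterm_le (β := (p - 2) / 3) (γ := p - 1) r hy hm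
      (by rw [hm0]; exact norm_Ssum_zero_zero)
      (fun a ha => by rw [hm0]; exact norm_Ssum_zero_right hp3 hp2 hr hε ha)
    have hm' : (0 : ℝ) < m := by exact_mod_cast hm
    have hmy : 0 < m * y := by positivity
    have hg := gker_pos hmy
    have hg2 := gker_mul_le hmy hp.pos
    rw [le_div_iff₀ (by linarith)] at hg2
    have hg3 := gker_pos (z := p * (m * y)) (by positivity)
    nlinarith

theorem Aterm_sum_two {p : ℕ} [Fact p.Prime] (hp2 : p = 2)
    (r : GaloisField p 2) (hr : r ^ 2 = algebraMap (ZMod p) (GaloisField p 2) (nsEps p))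
    {y : ℝ} (hy : 0 < y) (N : ℕ) : ∑ m ∈ Finset.Icc 1 N, Aterm p r y m / m ≤
      (4 * Real.sqrt p / 3) * (Real.pi ^ 2 / 6) / y := by
  subst hp2
  have hsq : 1 ≤ Real.sqrt (2 : ℕ) := Real.one_le_sqrt.mpr (by norm_num)
  refine lambert_sum (κ := 1) one_lt_two hy (by positivity) (by norm_num)
    (by push_cast at hsq ⊢; nlinarith) _ ?_ ?_ N
  · intro m hm hpm
    have hm0 : (m : ZMod 2) ≠ 0 := by rwa [Ne, ZMod.natCast_eq_zero_iff]
    have hS : ∀ a : ZMod 2, ‖Ssum 2 r a m‖ ≤ 0 := by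
      intro a
      have := norm_Ssum_two hr a m
      rwa [if_neg (fun h => hm0 h.2)] at this
    have h := Aterm_le r hy hm (hS 0) (fun a _ => hS a)
    have hm' : (0 : ℝ) < m := by exact_mod_cast hm
    have hmy : 0 < m * y := by positivity
    have hg := gker_pos hmy
    have hg2 := gker_mul_le hmy two_pos
    push_cast at *
    nlinarith
  · intro m hm hpm
    have hm0 : (m : ZMod 2) = 0 := by rwa [ZMod.natCast_eq_zero_iff]
    have h := Aterm_le (β := 2) (γ := 0) r hy hm
      (by
        have := norm_Ssum_two hr 0 m
        rwa [if_neg (fun h => h.1 rfl)] at this)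
      (fun a ha => by
        have := norm_Ssum_two hr a m
        rwa [if_pos ⟨ha, hm0⟩] at this)
    have hm' : (0 : ℝ) < m := by exact_mod_cast hm
    have hg3 := gker_pos (z := (2 : ℕ) * (m * y)) (by positivity)
    push_cast at *
    nlinarith

end Assembly

/-- **Proposition `logR`**: for a prime `p ≡ 2 (mod 3)` and `τ` in the upper half plane,
`|log|R|| ≤ -4π²·p·√p / (3·log|q|)` (note `log|q| < 0`). -/
theorem abs_log_Rprod_le (p : ℕ) [Fact p.Prime] (hp3 : p % 3 = 2)
    (r : GaloisField p 2)
    (hr : r ^ 2 = algebraMap (ZMod p) (GaloisField p 2) (nsEps p))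
    (τ : ℂ) (hτ : 0 < τ.im) :
    |Real.log (‖Rprod p r τ‖)| ≤
      -(4 * Real.pi ^ 2 * p * Real.sqrt p) / (3 * Real.log (‖qpow τ 1‖)) := by
  have hp : p.Prime := Fact.out
  have hp0 : (0 : ℝ) < p := by exact_mod_cast hp.pos
  set y := 2 * Real.pi * τ.im * (1 / p) with hy
  have hy0 : 0 < y := by
    rw [hy]
    have := Real.pi_pos
    positivity
  have hmain : ∀ N, ∑ m ∈ Finset.Icc 1 N, Aterm p r y m / m ≤
      (4 * Real.sqrt p / 3) * (Real.pi ^ 2 / 6) / y := by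
    by_cases hp2 : p = 2
    · exact Aterm_sum_two hp2 r hr hy0
    · exact Aterm_sum_odd hp3 hp2 r hr hy0
  refine (abs_log_bound r τ hy0 hy.symm hmain).trans (le_of_eq ?_)
  rw [norm_qpow, Real.log_exp, hy]
  have := Real.pi_pos
  field_simp
end

section
/- Let p be a prime with p ≡ 2 (mod 3) and let s ≥ p be an integer. Then |D(s)| < (2π²/9)·s·√p, where D(s) = ∑_{m ≤ s, p ∤ m} (∑_{k | m} 1/k) · c(m). -/
/-- `c(s) = ∑_{b ∈ F(s)} e^{2πi b̃/p}`, where `F(s) = {b ∈ 𝔽_p : (s, b) ∈ O_cubes}` and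
`b̃ ∈ {0, …, p-1}` is the integer representative of `b`. -/
noncomputable def cfun (p : ℕ) [Fact p.Prime] (r : GaloisField p 2) (s : ZMod p) : ℂ :=
  ∑ᶠ b ∈ {b : ZMod p | (s, b) ∈ Ocubes p r},
    Complex.exp (2 * Real.pi * Complex.I * (ZMod.val b : ℂ) / p)

/-- `D(s) = ∑_{m ≤ s, p ∤ m} (∑_{k ∣ m} 1/k) · c(m)`, where for a positive integer `m`, `c(m)`
denotes `c(m mod p)`. -/
noncomputable def Dfun (p : ℕ) [Fact p.Prime] (r : GaloisField p 2) (s : ℕ) : ℂ :=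
  ∑ m ∈ Finset.Icc 1 s,
    if ¬ p ∣ m then (∑ k ∈ m.divisors, (1 : ℂ) / k) * cfun p r (m : ZMod p) else 0

lemma sum_w_le (n : ℕ) : ∑ k ∈ Finset.Icc 1 (n+1), (1:ℝ) / (k * √k) ≤ 3 - 2 / √((n:ℝ)+1) := by
  induction n with
  | zero => norm_num
  | succ n ih =>
    rw [Finset.sum_Icc_succ_top (by omega)]
    push_cast
    have h0 : (0:ℝ) < (n:ℝ)+1 := by positivity
    set x := √((n:ℝ)+1) with hx
    set y := √((n:ℝ)+1+1) with hy
    have hx0 : 0 < x := Real.sqrt_pos.2 h0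
    have hy0 : 0 < y := Real.sqrt_pos.2 (by positivity)
    have hxx : x^2 = (n:ℝ)+1 := Real.sq_sqrt h0.le
    have hyy : y^2 = (n:ℝ)+1+1 := Real.sq_sqrt (by positivity)
    have hxy : x ≤ y := Real.sqrt_le_sqrt (by linarith)
    have key : 1 / (((n:ℝ)+1+1) * y) ≤ 2 / x - 2 / y := by
      rw [← hyy, div_sub_div _ _ hx0.ne' hy0.ne', div_le_div_iff₀ (by positivity) (by positivity)]
      have h1 : (y - x) * (y + x) = 1 := by nlinarith
      have h2 : 0 ≤ y - x := by linarith
      have h3 : 1 ≤ (y - x) * (2 * y) := by nlinarith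
      have h4 : x * y ≤ y ^ 2 := by nlinarith
      have h5 : 0 ≤ y ^ 2 := by positivity
      nlinarith [mul_le_mul_of_nonneg_left h3 h5]
    linarith

lemma sum_w_le' (n : ℕ) : ∑ k ∈ Finset.Icc 1 n, (1:ℝ) / (k * √k) ≤ 3 := by
  cases n with
  | zero => norm_num
  | succ n =>
    have := sum_w_le n
    have h : 0 ≤ 2 / √((n:ℝ)+1) := by positivity
    linarith

lemma sigma_sq_le (m : ℕ) :
    (∑ k ∈ m.divisors, (1:ℝ) / k) ^ 2 ≤ 3 * ∑ k ∈ m.divisors, (1:ℝ) / √k := by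
  have h := Finset.sum_sq_le_sum_mul_sum_of_sq_eq_mul m.divisors
    (r := fun k : ℕ => (1:ℝ) / k) (f := fun k : ℕ => (1:ℝ) / (k * √k))
    (g := fun k : ℕ => (1:ℝ) / √k)
    (fun i _ => by positivity) (fun i _ => by positivity) (fun i hi => by
      have hi0 : (0:ℝ) < i := by exact_mod_cast Nat.pos_of_mem_divisors hi
      have := Real.mul_self_sqrt hi0.le
      rw [div_mul_div_comm, mul_assoc, this]
      simp [sq])
  refine h.trans (mul_le_mul_of_nonneg_right ?_ (Finset.sum_nonneg fun i _ => by positivity))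
  refine le_trans (Finset.sum_le_sum_of_subset_of_nonneg ?_ fun i _ _ => by positivity)
    (sum_w_le' m)
  intro k hk
  exact Finset.mem_Icc.2 ⟨Nat.pos_of_mem_divisors hk, Nat.divisor_le hk⟩

lemma sum_sigma_sq_le (s : ℕ) :
    ∑ m ∈ Finset.Icc 1 s, (∑ k ∈ m.divisors, (1:ℝ) / k) ^ 2 ≤ 9 * s := by
  have h1 : ∑ m ∈ Finset.Icc 1 s, ∑ k ∈ m.divisors, (1:ℝ) / √k ≤ 3 * s := by
    have e : ∀ m ∈ Finset.Icc 1 s, ∑ k ∈ m.divisors, (1:ℝ) / √k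
        = ∑ k ∈ Finset.Icc 1 s, if k ∣ m then (1:ℝ) / √k else 0 := by
      intro m hm
      rw [Finset.mem_Icc] at hm
      rw [← Finset.sum_filter]
      refine Finset.sum_congr ?_ fun _ _ => rfl
      ext k
      simp only [Nat.mem_divisors, Finset.mem_filter, Finset.mem_Icc]
      constructor
      · rintro ⟨h, h'⟩
        exact ⟨⟨Nat.pos_of_dvd_of_pos h (by omega), (Nat.le_of_dvd (by omega) h).trans hm.2⟩, h⟩
      · rintro ⟨_, h⟩
        exact ⟨h, by omega⟩
    rw [Finset.sum_congr rfl e, Finset.sum_comm]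
    calc _ ≤ ∑ k ∈ Finset.Icc 1 s, (s:ℝ) * ((1:ℝ) / (k * √k)) := by
          refine Finset.sum_le_sum fun k hk => ?_
          rw [Finset.mem_Icc] at hk
          have hk0 : (0:ℝ) < k := by exact_mod_cast hk.1
          rw [← Finset.sum_filter, Finset.sum_const, nsmul_eq_mul]
          have hc : (Finset.filter (fun m => k ∣ m) (Finset.Icc 1 s)).card = s / k :=
            Nat.Ioc_filter_dvd_card_eq_div s k
          rw [hc]
          have : ((s / k : ℕ) : ℝ) ≤ s / k := Nat.cast_div_le
          calc _ ≤ (s:ℝ) / k * (1 / √k) := mul_le_mul_of_nonneg_right this (by positivity)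
            _ = _ := by rw [div_mul_div_comm, mul_one_div, mul_one]
      _ = s * ∑ k ∈ Finset.Icc 1 s, ((1:ℝ) / (k * √k)) := by rw [Finset.mul_sum]
      _ ≤ s * 3 := mul_le_mul_of_nonneg_left (sum_w_le' s) (by positivity)
      _ = 3 * s := mul_comm _ _
  calc _ ≤ ∑ m ∈ Finset.Icc 1 s, 3 * ∑ k ∈ m.divisors, (1:ℝ) / √k :=
        Finset.sum_le_sum fun m _ => sigma_sq_le m
    _ = 3 * ∑ m ∈ Finset.Icc 1 s, ∑ k ∈ m.divisors, (1:ℝ) / √k := by rw [Finset.mul_sum]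
    _ ≤ _ := by linarith

lemma exists_cube_root (p : ℕ) [Fact p.Prime] (hp3 : p % 3 = 2) (a : ZMod p) :
    ∃ t : ZMod p, t ^ 3 = a := by
  refine ⟨a ^ ((2 * p - 1) / 3), ?_⟩
  obtain ⟨q, hq⟩ : ∃ q, p = 3 * q + 2 := ⟨p / 3, by omega⟩
  have h : (2 * p - 1) / 3 * 3 = p + (p - 1) := by omega
  rw [← pow_mul, h, pow_add, ZMod.pow_card]
  by_cases ha : a = 0
  · simp [ha]
  · rw [ZMod.pow_card_sub_one_eq_one ha, mul_one]

lemma mem_Ocubes_mul (p : ℕ) [Fact p.Prime] (hp3 : p % 3 = 2) (r : GaloisField p 2)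
    {s : ZMod p} (hs : s ≠ 0) {x b : ZMod p} (h : (x, b) ∈ Ocubes p r) :
    (s * x, s * b) ∈ Ocubes p r := by
  obtain ⟨h0, c, hc, hcc⟩ := h
  obtain ⟨t, ht⟩ := exists_cube_root p hp3 s
  have ht0 : t ≠ 0 := by rintro rfl; exact hs (by rw [← ht]; simp)
  refine ⟨?_, algebraMap _ _ t * c, mul_ne_zero ?_ hc, ?_⟩
  · intro h
    apply h0
    simp only [Prod.mk_eq_zero, mul_eq_zero, hs, false_or] at h ⊢
    exact h
  · simpa using ht0
  · rw [mul_pow, hcc, ← map_pow, ht]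
    simp only [map_mul]
    ring

open Classical in
lemma cfun_eq (p : ℕ) [Fact p.Prime] (hp3 : p % 3 = 2) (r : GaloisField p 2)
    {s : ZMod p} (hs : s ≠ 0) :
    cfun p r s = ∑ b ∈ Finset.univ.filter (fun b => ((1 : ZMod p), b) ∈ Ocubes p r),
      ZMod.stdAddChar (s * b) := by
  have h1 : cfun p r s = ∑ b ∈ Finset.univ.filter (fun b => (s, b) ∈ Ocubes p r),
      ZMod.stdAddChar b := by
    unfold cfun
    rw [finsum_mem_eq_finite_toFinset_sum _ (Set.toFinite _)]
    refine Finset.sum_congr (by ext; simp) fun b _ => ?_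
    have h := ZMod.stdAddChar_coe (N := p) (b.val : ℤ)
    rw [Int.cast_natCast, ZMod.natCast_zmod_val] at h
    rw [h, Int.cast_natCast]
  rw [h1]
  symm
  refine Finset.sum_bij (fun b _ => s * b) ?_ ?_ ?_ ?_
  · intro b hb
    simp only [Finset.mem_filter, Finset.mem_univ, true_and] at hb ⊢
    simpa using mem_Ocubes_mul p hp3 r hs hb
  · intro a _ b _ h
    exact mul_left_cancel₀ hs h
  · intro b hb
    simp only [Finset.mem_filter, Finset.mem_univ, true_and] at hb
    refine ⟨s⁻¹ * b, ?_, by field_simp⟩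
    simp only [Finset.mem_filter, Finset.mem_univ, true_and]
    simpa [hs] using mem_Ocubes_mul p hp3 r (inv_ne_zero hs) hb
  · intro b _
    rfl

lemma parseval (p : ℕ) [Fact p.Prime] (A : Finset (ZMod p)) :
    ∑ a : ZMod p, ‖∑ b ∈ A, ZMod.stdAddChar (a * b)‖ ^ 2 = (p : ℝ) * A.card := by
  have : (∑ a : ZMod p, ((‖∑ b ∈ A, ZMod.stdAddChar (a * b)‖ ^ 2 : ℝ) : ℂ))
      = (p : ℂ) * A.card := by
    have e : ∀ a : ZMod p, ((‖∑ b ∈ A, ZMod.stdAddChar (a * b)‖ ^ 2 : ℝ) : ℂ)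
        = ∑ b ∈ A, ∑ b' ∈ A, ZMod.stdAddChar (a * (b - b')) := by
      intro a
      push_cast
      rw [← Complex.mul_conj', map_sum, Finset.sum_mul_sum]
      refine Finset.sum_congr rfl fun b _ => Finset.sum_congr rfl fun b' _ => ?_
      rw [← AddChar.map_neg_eq_conj, ← AddChar.map_add_eq_mul]
      congr 1
      ring
    simp_rw [e]
    rw [Finset.sum_comm]
    have e2 : ∀ b ∈ A, ∑ a : ZMod p, ∑ b' ∈ A, (ZMod.stdAddChar (a * (b - b')) : ℂ) = p := by
      intro b hb
      rw [Finset.sum_comm]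
      simp_rw [AddChar.sum_mulShift _ (ZMod.isPrimitive_stdAddChar p), sub_eq_zero]
      simp [hb, ZMod.card]
    rw [Finset.sum_congr rfl e2]
    simp [mul_comm]
  exact_mod_cast this

lemma sum_range_periodic (p : ℕ) [Fact p.Prime] (g : ZMod p → ℝ) (q : ℕ) :
    ∑ m ∈ Finset.range (q * p), g (m : ZMod p) = q * ∑ a : ZMod p, g a := by
  induction q with
  | zero => simp
  | succ q ih =>
    rw [Nat.succ_mul, Finset.sum_range_add, ih]
    have : ∑ x ∈ Finset.range p, g ((q * p + x : ℕ) : ZMod p) = ∑ a : ZMod p, g a := by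
      refine Finset.sum_bij (fun x _ => (x : ZMod p)) (fun _ _ => Finset.mem_univ _) ?_ ?_ ?_
      · intro a ha b hb h
        rw [Finset.mem_range] at ha hb
        rw [ZMod.natCast_eq_natCast_iff] at h
        exact Nat.ModEq.eq_of_lt_of_lt h ha hb
      · intro b _
        exact ⟨b.val, Finset.mem_range.2 (ZMod.val_lt b), ZMod.natCast_zmod_val b⟩
      · intro a _
        simp
    rw [this]
    push_cast
    ring

lemma sum_c_sq_le (p : ℕ) [Fact p.Prime] (hp3 : p % 3 = 2) (r : GaloisField p 2)
    (s : ℕ) (hs : p ≤ s) :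
    ∑ m ∈ Finset.Icc 1 s, (if ¬ p ∣ m then ‖cfun p r (m : ZMod p)‖ else 0) ^ 2
      ≤ (s : ℝ) * p / 2 := by
  classical
  have hp : 0 < p := (Fact.out : p.Prime).pos
  set g : ZMod p → ℝ := fun a => if a = 0 then 0 else ‖cfun p r a‖ ^ 2 with hg
  have hg0 : ∀ a, 0 ≤ g a := by intro a; simp only [hg]; split_ifs <;> positivity
  have e : ∀ m : ℕ, (if ¬ p ∣ m then ‖cfun p r (m : ZMod p)‖ else 0) ^ 2 = g m := by
    intro m
    simp only [hg, ZMod.natCast_eq_zero_iff]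
    split_ifs <;> simp
  have htot : ∑ a, g a ≤ (p:ℝ) ^ 2 / 4 := by
    set A := Finset.univ.filter (fun b => ((1 : ZMod p), b) ∈ Ocubes p r) with hA
    have hpar := parseval p A
    rw [← Finset.add_sum_erase _ _ (Finset.mem_univ (0 : ZMod p))] at hpar ⊢
    have h2 : ∑ a ∈ Finset.univ.erase (0 : ZMod p), g a
        = ∑ a ∈ Finset.univ.erase (0 : ZMod p), ‖∑ b ∈ A, ZMod.stdAddChar (a * b)‖ ^ 2 := by
      refine Finset.sum_congr rfl fun a ha => ?_
      have ha0 := Finset.ne_of_mem_erase ha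
      simp only [hg, if_neg ha0]
      rw [cfun_eq p hp3 r ha0]
    rw [h2]
    simp only [hg, if_true]
    simp only [zero_mul, AddChar.map_zero_eq_one, Finset.sum_const, nsmul_eq_mul, mul_one,
      Complex.norm_natCast] at hpar
    nlinarith [sq_nonneg ((p:ℝ) / 2 - A.card)]
  simp_rw [e]
  calc _ ≤ ∑ m ∈ Finset.range ((s / p + 1) * p), g (m : ZMod p) := by
        refine Finset.sum_le_sum_of_subset_of_nonneg ?_ fun i _ _ => hg0 _
        intro m hm
        rw [Finset.mem_Icc] at hm
        rw [Finset.mem_range]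
        have := Nat.lt_div_mul_add (a := s) hp
        rw [Nat.succ_mul]
        omega
    _ = ((s / p + 1 : ℕ) : ℝ) * ∑ a, g a := sum_range_periodic p g _
    _ ≤ (2 * (s / p : ℝ)) * ((p:ℝ) ^ 2 / 4) := by
        have h1 : ((s / p : ℕ) : ℝ) ≤ s / p := Nat.cast_div_le
        have h2 : (1:ℝ) ≤ s / p := by
          rw [one_le_div (by exact_mod_cast hp)]
          exact_mod_cast hs
        refine mul_le_mul ?_ htot (Finset.sum_nonneg fun a _ => hg0 a) (by positivity)
        push_cast
        linarith
    _ = _ := by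
        have : (p:ℝ) ≠ 0 := by exact_mod_cast hp.ne'
        field_simp
        ring

theorem abs_Dfun_lt (p : ℕ) [Fact p.Prime] (hp3 : p % 3 = 2)
    (r : GaloisField p 2)
    (hr : r ^ 2 = algebraMap (ZMod p) (GaloisField p 2) (nsEps p))
    (s : ℕ) (hs : p ≤ s) :
    ‖Dfun p r s‖ < 2 * Real.pi ^ 2 / 9 * s * Real.sqrt p := by
  have hp : 0 < p := (Fact.out : p.Prime).pos
  have hp' : (0:ℝ) < p := by exact_mod_cast hp
  have hs' : (0:ℝ) < s := by exact_mod_cast hp.trans_le hs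
  have h1 : ‖Dfun p r s‖ ≤ ∑ m ∈ Finset.Icc 1 s, (∑ k ∈ m.divisors, (1:ℝ) / k) *
      (if ¬ p ∣ m then ‖cfun p r (m : ZMod p)‖ else 0) := by
    unfold Dfun
    refine (norm_sum_le _ _).trans (Finset.sum_le_sum fun m _ => ?_)
    split_ifs
    · simp
    · rw [norm_mul]
      refine mul_le_mul_of_nonneg_right ((norm_sum_le _ _).trans (le_of_eq ?_)) (norm_nonneg _)
      simp
  have h2 := Finset.sum_mul_sq_le_sq_mul_sq (Finset.Icc 1 s)
    (fun m : ℕ => ∑ k ∈ m.divisors, (1:ℝ) / k)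
    (fun m : ℕ => if ¬ p ∣ m then ‖cfun p r (m : ZMod p)‖ else 0)
  have h3 : ‖Dfun p r s‖ ^ 2 ≤ (9 * s) * ((s : ℝ) * p / 2) := by
    refine (pow_le_pow_left₀ (norm_nonneg _) h1 2).trans (h2.trans ?_)
    exact mul_le_mul (sum_sigma_sq_le s) (sum_c_sq_le p hp3 r s hs)
      (Finset.sum_nonneg fun _ _ => sq_nonneg _) (by positivity)
  refine lt_of_pow_lt_pow_left₀ 2 (by positivity) (h3.trans_lt ?_)
  rw [mul_pow, Real.sq_sqrt hp'.le, mul_pow]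
  have hpi : (9.8 : ℝ) < Real.pi ^ 2 := by nlinarith [Real.pi_gt_d2]
  have hc : (9/2 : ℝ) < (2 * Real.pi ^ 2 / 9) ^ 2 := by nlinarith
  have : 0 < (s:ℝ) ^ 2 * p := by positivity
  nlinarith [mul_lt_mul_of_pos_right hc this]
end

section
/- Let p be a positive integer, let τ be a point of the complex upper half plane with |Re(τ)| ≤ 1/2 (e.g. τ in the standard fundamental domain for SL₂(ℤ)), let q = e^{2πiτ}, and let q^{1/p} denote e^{2πiτ/p}. Then |1 − q^{1/p}| < 1 − |q|^{1/p} + |q|^{1/(2p)}·π/p. -/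
/-- **Lemma `lemminotecnico1`**: let `p` be a positive integer, `τ` a point of the upper half
plane with `|Re τ| ≤ 1/2` (e.g. `τ` in the standard fundamental domain for `SL₂(ℤ)`), let
`q = e^{2πiτ}` and let `q^{1/p}` denote `e^{2πiτ/p}`.  Then
`|1 - q^{1/p}| < 1 - |q|^{1/p} + |q|^{1/(2p)}·π/p`. -/
theorem abs_one_sub_q_pow_inv_lt (p : ℕ) (hp : 0 < p) (τ : ℂ) (hτ : 0 < τ.im)
    (hre : |τ.re| ≤ 1 / 2) :
    ‖1 - Complex.exp (2 * Real.pi * Complex.I * τ / p)‖ <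
      1 - ‖Complex.exp (2 * Real.pi * Complex.I * τ)‖ ^ ((1 : ℝ) / p)
        + ‖Complex.exp (2 * Real.pi * Complex.I * τ)‖ ^ ((1 : ℝ) / (2 * p))
          * Real.pi / p := by
  have hp' : (0 : ℝ) < p := by exact_mod_cast hp
  have hπ := Real.pi_pos
  have hpc : (p : ℂ) ≠ 0 := by exact_mod_cast hp.ne'
  obtain ⟨s, hs⟩ : ∃ s : ℝ, s = Real.exp (-(Real.pi * τ.im / p)) := ⟨_, rfl⟩
  obtain ⟨θ, hθ⟩ : ∃ θ : ℝ, θ = 2 * Real.pi * τ.re / p := ⟨_, rfl⟩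
  have hn : ‖Complex.exp (2 * Real.pi * Complex.I * τ)‖ = Real.exp (-(2 * Real.pi * τ.im)) := by
    rw [Complex.norm_exp]
    simp
  have h1 : ‖Complex.exp (2 * Real.pi * Complex.I * τ)‖ ^ ((1 : ℝ) / p) = s ^ 2 := by
    rw [hn, ← Real.exp_mul, hs, ← Real.exp_nat_mul]
    congr 1
    push_cast
    field_simp
  have h2 : ‖Complex.exp (2 * Real.pi * Complex.I * τ)‖ ^ ((1 : ℝ) / (2 * p)) = s := by
    rw [hn, ← Real.exp_mul, hs]
    congr 1
    field_simp
  have hs0 : 0 < s := hs ▸ Real.exp_pos _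
  have hs1 : s < 1 := by
    rw [hs, Real.exp_lt_one_iff]
    have : 0 < Real.pi * τ.im / p := by positivity
    linarith
  have h3 : Complex.exp (2 * Real.pi * Complex.I * τ / p)
      = ((s ^ 2 : ℝ) : ℂ) * (Real.cos θ + Real.sin θ * Complex.I) := by
    rw [Complex.ofReal_cos, Complex.ofReal_sin, ← Complex.exp_mul_I, hs, ← Real.exp_nat_mul,
      Complex.ofReal_exp, ← Complex.exp_add]
    congr 1
    rw [hθ]
    conv_lhs => rw [← Complex.re_add_im τ]
    push_cast
    field_simp
    ring_nf
    rw [Complex.I_sq]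
    ring
  have h4 : ‖1 - Complex.exp (2 * Real.pi * Complex.I * τ / p)‖ ^ 2
      = (1 - s ^ 2) ^ 2 + 2 * s ^ 2 * (1 - Real.cos θ) := by
    rw [h3, Complex.sq_norm, Complex.normSq_apply]
    simp only [Complex.sub_re, Complex.sub_im, Complex.one_re, Complex.one_im,
      Complex.re_ofReal_mul, Complex.im_ofReal_mul, Complex.add_re, Complex.add_im,
      Complex.ofReal_re, Complex.ofReal_im, Complex.I_re, Complex.I_im]
    linear_combination s ^ 4 * Real.sin_sq_add_cos_sq θ
  have hcos := Real.one_sub_sq_div_two_le_cos (x := θ)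
  have hθ2 : θ ^ 2 ≤ (Real.pi / p) ^ 2 := by
    apply sq_le_sq'
    · rw [hθ, ← neg_div]
      gcongr
      nlinarith [(abs_le.mp hre).1]
    · rw [hθ]
      gcongr
      nlinarith [(abs_le.mp hre).2]
  have ha : 0 < Real.pi / p := by positivity
  rw [h1, h2, mul_div_assoc s]
  generalize Real.pi / (p : ℝ) = a at *
  have hr : 0 < 1 - s ^ 2 := by nlinarith
  have hsa : 0 < s * a := mul_pos hs0 ha
  apply lt_of_pow_lt_pow_left₀ 2 (by linarith)
  rw [h4]
  have e1 : s ^ 2 * (2 * (1 - Real.cos θ)) ≤ s ^ 2 * a ^ 2 :=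
    mul_le_mul_of_nonneg_left (by linarith) (sq_nonneg s)
  nlinarith [mul_pos hr hsa]
end
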